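/- arXiv:1303.2302 — 3 statements merged into one kernel-verified Lean document; each statement's English description precedes it below -/
import Mathlib

section
/- For every natural number n, f_n^+(x) = Σ_{k=0}^n (−1)^{n−k} (n choose k) B_k^+(x). -/
open Polynomial Finset

/-- A signed permutation of `[n]`, encoded by its word: position `i` (0-indexed)
holds the pair (absolute value minus one, sign) of the letter `w(a_{i+1})`. -/
def IsSP {n : ℕ} (u : Fin n → Fin n × Bool) : Prop :=
  Function.Bijective fun i => (u i).1

instance {n : ℕ} (u : Fin n → Fin n × Bool) : Decidable (IsSP u) :=
  inferInstanceAs (Decidable (Function.Bijective _))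

/-- the letter `w(a_{i+1})` at position `i` of the word -/
def letterW {n : ℕ} (u : Fin n → Fin n × Bool) (i : Fin n) : ℤ :=
  if (u i).2 then ((u i).1 : ℤ) + 1 else -(((u i).1 : ℤ) + 1)

/-- `a_{k+1}`: the element of the domain `S` with absolute value `k+1` -/
def aVal {n : ℕ} (u : Fin n → Fin n × Bool) (k : Fin n) : ℤ :=
  if ∃ j, u j = (k, true) then ((k : ℤ) + 1) else -((k : ℤ) + 1)

/-- the number of type `B` excedances -/
def excB {n : ℕ} (u : Fin n → Fin n × Bool) : ℕ :=
  (univ.filter fun k : Fin n =>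
    aVal u k < letterW u k ∨ (aVal u k < 0 ∧ letterW u k = aVal u k)).card

/-- a derangement: no positive fixed point -/
def IsDerB {n : ℕ} (u : Fin n → Fin n × Bool) : Prop :=
  ∀ k : Fin n, 0 < aVal u k → letterW u k ≠ aVal u k

instance {n : ℕ} (u : Fin n → Fin n × Bool) : Decidable (IsDerB u) := by
  unfold IsDerB; infer_instance

/-- the type `B` derangement polynomial -/
noncomputable def dB (n : ℕ) : Polynomial ℝ :=
  ∑ u ∈ univ.filter (fun u : Fin n → Fin n × Bool => IsSP u ∧ IsDerB u), X ^ excB u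

/-- the number of type `B` descents -/
def desB {n : ℕ} (u : Fin n → Fin n × Bool) : ℕ :=
  (univ.filter fun i : Fin n =>
    ((i : ℕ) = 0 ∧ letterW u i < 0) ∨
    (0 < (i : ℕ) ∧ letterW u i < letterW u ⟨(i : ℕ) - 1, by have := i.isLt; omega⟩)).card

/-- the type `B` Eulerian polynomial -/
noncomputable def Bpoly (n : ℕ) : Polynomial ℝ :=
  ∑ u ∈ univ.filter (fun u : Fin n → Fin n × Bool => IsSP u), X ^ desB u

/-- the "positive half" type `B` Eulerian polynomial -/
noncomputable def Bplus : ℕ → Polynomial ℝ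
  | 0 => 1
  | n + 1 =>
    ∑ u ∈ univ.filter (fun u : Fin (n + 1) → Fin (n + 1) × Bool =>
        IsSP u ∧ 0 < letterW u (Fin.last n)), X ^ desB u

/-- the "negative half" type `B` Eulerian polynomial -/
noncomputable def Bminus : ℕ → Polynomial ℝ
  | 0 => 0
  | n + 1 =>
    ∑ u ∈ univ.filter (fun u : Fin (n + 1) → Fin (n + 1) × Bool =>
        IsSP u ∧ letterW u (Fin.last n) < 0), X ^ desB u

/-- the number of excedances of a permutation -/
def excA {n : ℕ} (w : Equiv.Perm (Fin n)) : ℕ :=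
  (univ.filter fun i : Fin n => i < w i).card

/-- the number of descents of a permutation -/
def desA {n : ℕ} (w : Equiv.Perm (Fin n)) : ℕ :=
  (univ.filter fun i : Fin n =>
    (i : ℕ) + 1 < n ∧ w ⟨((i : ℕ) + 1) % n, Nat.mod_lt _ i.pos⟩ < w i).card

/-- the (type `A`) derangement polynomial -/
noncomputable def dA (n : ℕ) : Polynomial ℝ :=
  ∑ w ∈ univ.filter (fun w : Equiv.Perm (Fin n) => ∀ i, w i ≠ i), X ^ excA w

/-- the Eulerian polynomial, with the convention `A_0 = 0` -/
noncomputable def Apoly (n : ℕ) : Polynomial ℝ :=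
  if n = 0 then 0 else ∑ w : Equiv.Perm (Fin n), X ^ desA w


/-! ### Part A: algebra -/

/-- The operator sending a to 2 n x a + 2 x (1 - x) times the derivative of a. -/
noncomputable def Lop (n : ℕ) (a : Polynomial ℝ) : Polynomial ℝ :=
  2 * (n : Polynomial ℝ) * X * a + 2 * X * (1 - X) * derivative a

/-- alternating binomial transform -/
noncomputable def Tr (a : ℕ → Polynomial ℝ) (n : ℕ) : Polynomial ℝ :=
  ∑ k ∈ Finset.range (n + 1), (-1 : Polynomial ℝ) ^ (n - k) * (n.choose k : Polynomial ℝ) * a k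

theorem Tr_zero (a : ℕ → Polynomial ℝ) : Tr a 0 = a 0 := by simp [Tr]

theorem Tr_add (a b : ℕ → Polynomial ℝ) (n : ℕ) :
    Tr (fun k => a k + b k) n = Tr a n + Tr b n := by
  simp only [Tr, mul_add, Finset.sum_add_distrib]

theorem Tr_mul (c : Polynomial ℝ) (a : ℕ → Polynomial ℝ) (n : ℕ) :
    Tr (fun k => c * a k) n = c * Tr a n := by
  simp only [Tr, Finset.mul_sum]
  exact Finset.sum_congr rfl fun k _ => by ring

theorem Tr_succ (a : ℕ → Polynomial ℝ) (n : ℕ) :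
    Tr a (n + 1) = Tr (fun k => a (k + 1)) n - Tr a n := by
  have h : ∀ (n : ℕ) (a : ℕ → Polynomial ℝ), Tr a n = (fwdDiff 1)^[n] a 0 := by
    intro n a
    rw [fwdDiff_iter_eq_sum_shift]
    refine Finset.sum_congr rfl fun k _ => ?_
    simp [zsmul_eq_mul]
  rw [h, h, h, Function.iterate_succ_apply]
  have : fwdDiff 1 a = (fun k => a (k + 1)) - a := by
    funext k; simp [fwdDiff]
  rw [this]
  simp only [fwdDiff_iter_eq_sum_shift, Pi.sub_apply, smul_sub, Finset.sum_sub_distrib]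

theorem Tr_deriv (a : ℕ → Polynomial ℝ) (n : ℕ) :
    Tr (fun k => derivative (a k)) n = derivative (Tr a n) := by
  simp only [Tr, derivative_sum]
  refine Finset.sum_congr rfl fun k _ => ?_
  have : (-1 : Polynomial ℝ) ^ (n - k) * (n.choose k : Polynomial ℝ)
      = C ((-1) ^ (n - k) * (n.choose k : ℝ)) := by simp
  rw [this, derivative_C_mul]

theorem Tr_nat_zero (a : ℕ → Polynomial ℝ) :
    Tr (fun k => (k : Polynomial ℝ) * a k) 0 = 0 := by simp [Tr]

theorem Tr_nat_succ (a : ℕ → Polynomial ℝ) (n : ℕ) :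
    Tr (fun k => (k : Polynomial ℝ) * a k) (n + 1)
      = ((n + 1 : ℕ) : Polynomial ℝ) * (Tr a (n + 1) + Tr a n) := by
  have h1 : Tr (fun k => (k : Polynomial ℝ) * a k) (n + 1)
      = ((n + 1 : ℕ) : Polynomial ℝ) * Tr a (n + 1)
        - ∑ k ∈ Finset.range (n + 1 + 1), (-1 : Polynomial ℝ) ^ (n + 1 - k) *
          ((n + 1).choose k : Polynomial ℝ) * (((n + 1 - k : ℕ) : Polynomial ℝ) * a k) := by
    simp only [Tr, Finset.mul_sum]
    rw [← Finset.sum_sub_distrib]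
    refine Finset.sum_congr rfl fun k hk => ?_
    rw [Nat.cast_sub (by simpa [Nat.lt_succ_iff] using hk)]
    ring
  rw [h1, mul_add, sub_eq_add_neg, add_right_inj, Finset.sum_range_succ]
  simp only [Nat.sub_self, Nat.cast_zero, zero_mul, mul_zero, add_zero]
  rw [Tr, Finset.mul_sum, ← Finset.sum_neg_distrib]
  refine Finset.sum_congr rfl fun k hk => ?_
  have hk' : k ≤ n := by simpa [Nat.lt_succ_iff] using hk
  have := congrArg (Nat.cast : ℕ → Polynomial ℝ) (Nat.choose_mul_succ_eq n k)
  push_cast [-Nat.cast_sub] at this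
  rw [Nat.succ_sub hk', pow_succ]
  push_cast
  rw [Nat.succ_sub hk'] at this
  push_cast at this
  linear_combination (-1 : Polynomial ℝ) ^ (n - k) * a k * (-this)

theorem Tr_Lop_zero (a : ℕ → Polynomial ℝ) :
    Tr (fun k => Lop k (a k)) 0 = Lop 0 (Tr a 0) := by
  simp [Tr_zero]

theorem Tr_Lop_succ (a : ℕ → Polynomial ℝ) (n : ℕ) :
    Tr (fun k => Lop k (a k)) (n + 1)
      = Lop (n + 1) (Tr a (n + 1)) + 2 * ((n + 1 : ℕ) : Polynomial ℝ) * X * Tr a n := by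
  have : (fun k => Lop k (a k)) = fun k : ℕ => (2 * X) * ((k : Polynomial ℝ) * a k)
      + (2 * X * (1 - X)) * derivative (a k) := by
    funext k; simp only [Lop]; ring
  rw [this, Tr_add, Tr_mul, Tr_mul (2 * X * (1 - X)), Tr_nat_succ, Tr_deriv, Lop]
  ring

theorem Lop_add (n : ℕ) (a b : Polynomial ℝ) : Lop n (a + b) = Lop n a + Lop n b := by
  simp only [Lop, derivative_add]; ring

theorem Lop_coeff_zero (n : ℕ) (a : Polynomial ℝ) : (Lop n a).coeff 0 = 0 := by
  simp [Lop, mul_assoc, Polynomial.mul_coeff_zero]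

theorem Lop_coeff_succ (n : ℕ) (a : Polynomial ℝ) (j : ℕ) :
    (Lop n a).coeff (j + 1) = 2 * ((n : ℝ) - j) * a.coeff j + 2 * ((j : ℝ) + 1) * a.coeff (j + 1) := by
  have : Lop n a = X * (C (2 * (n : ℝ)) * a + C 2 * derivative a - X * (C 2 * derivative a)) := by
    simp only [Lop, map_mul, map_natCast, map_ofNat]; ring
  rw [this, coeff_X_mul]
  cases j with
  | zero => simp [coeff_derivative]
  | succ j =>
    rw [coeff_sub, coeff_add, coeff_X_mul, coeff_C_mul, coeff_C_mul, coeff_C_mul,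
      coeff_derivative, coeff_derivative]
    push_cast; ring

/-- palindromic with center `c / 2` -/
def Pal (c : ℕ) (f : Polynomial ℝ) : Prop :=
  (∀ i j, i + j = c → f.coeff i = f.coeff j) ∧ ∀ i, c < i → f.coeff i = 0

theorem Pal.add {c : ℕ} {f g : Polynomial ℝ} (hf : Pal c f) (hg : Pal c g) : Pal c (f + g) :=
  ⟨fun i j h => by simp [hf.1 i j h, hg.1 i j h], fun i h => by simp [hf.2 i h, hg.2 i h]⟩

theorem Pal.natMul {c : ℕ} {f : Polynomial ℝ} (hf : Pal c f) (m : ℕ) :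
    Pal c ((m : Polynomial ℝ) * f) := by
  have : (m : Polynomial ℝ) = C (m : ℝ) := by simp
  rw [this]
  exact ⟨fun i j h => by simp [hf.1 i j h], fun i h => by simp [hf.2 i h]⟩

theorem Pal.X_mul {c : ℕ} {f : Polynomial ℝ} (hf : Pal c f) : Pal (c + 2) (X * f) := by
  refine ⟨fun i j h => ?_, fun i h => ?_⟩
  · rcases i with _ | i <;> rcases j with _ | j
    · simp
    · rw [coeff_X_mul, hf.2 j (by omega)]; simp
    · rw [coeff_X_mul, hf.2 i (by omega)]; simp
    · rw [coeff_X_mul, coeff_X_mul, hf.1 i j (by omega)]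
  · rcases i with _ | i
    · simp
    · rw [coeff_X_mul, hf.2 i (by omega)]

theorem Pal.Lop {n : ℕ} {f : Polynomial ℝ} (hf : Pal n f) : Pal (n + 1) (Lop n f) := by
  have key : ∀ j, n + 1 ≤ j + 1 → (_root_.Lop n f).coeff (j + 1) = 0 := by
    intro j hj
    rw [Lop_coeff_succ, hf.2 (j + 1) (by omega)]
    rcases Nat.lt_or_ge n j with h | h
    · rw [hf.2 j h]; ring
    · have : j = n := by omega
      subst this; ring
  refine ⟨fun i j h => ?_, fun i h => ?_⟩
  · rcases i with _ | i <;> rcases j with _ | j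
    · simp
    · rw [Lop_coeff_zero, key j (by omega)]
    · rw [Lop_coeff_zero, key i (by omega)]
    · rw [Lop_coeff_succ, Lop_coeff_succ, hf.1 i (j + 1) (by omega), hf.1 (i + 1) j (by omega)]
      have : n = i + j + 1 := by omega
      subst this; push_cast; ring
  · rcases i with _ | i
    · omega
    · exact key i (by omega)

theorem Pal.Lop' {n : ℕ} {f : Polynomial ℝ} (hf : Pal (n + 1) f) :
    Pal (n + 2) ((X - 1) * f + _root_.Lop n f) := by
  have h0 : f.coeff 0 = f.coeff (n + 1) := hf.1 0 (n + 1) (by omega)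
  have z : ((X - 1) * f + _root_.Lop n f).coeff 0 = - f.coeff 0 := by
    simp [Lop_coeff_zero, Polynomial.mul_coeff_zero]
  have s : ∀ j, ((X - 1) * f + _root_.Lop n f).coeff (j + 1)
      = (2 * ((n : ℝ) - j) + 1) * f.coeff j + (2 * (j : ℝ) + 1) * f.coeff (j + 1) := by
    intro j
    rw [coeff_add, Lop_coeff_succ, sub_mul, coeff_sub, coeff_X_mul, one_mul]; ring
  have key : ∀ j, n + 1 < j → ((X - 1) * f + _root_.Lop n f).coeff (j + 1) = 0 := by
    intro j hj
    rw [s, hf.2 j hj, hf.2 (j + 1) (by omega)]; ring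
  have key1 : ((X - 1) * f + _root_.Lop n f).coeff (n + 1 + 1) = - f.coeff 0 := by
    rw [s, hf.2 (n + 1 + 1) (by omega), h0]; push_cast; ring
  refine ⟨fun i j h => ?_, fun i h => ?_⟩
  · rcases i with _ | i <;> rcases j with _ | j
    · simp
    · have : j = n + 1 := by omega
      subst this; rw [z, key1]
    · have : i = n + 1 := by omega
      subst this; rw [z, key1]
    · rw [s, s, hf.1 i (j + 1) (by omega), hf.1 (i + 1) j (by omega)]
      have : (n : ℝ) = i + j := by exact_mod_cast (by omega : n = i + j)
      rw [this]; ring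
  · rcases i with _ | i
    · omega
    · exact key i (by omega)

section
variable {P M : ℕ → Polynomial ℝ}
  (hP : ∀ n, P (n + 1) = P n + M n + Lop n (P n))
  (hM : ∀ n, M (n + 1) = X * (P n + M n) + Lop n (M n))

theorem TrP_one (hP : ∀ n, P (n + 1) = P n + M n + Lop n (P n)) :
    Tr P 1 = Tr M 0 + Lop 0 (Tr P 0) := by
  rw [Tr_succ, show (fun k => P (k + 1)) = fun k => (P k + M k) + Lop k (P k) from funext hP,
    Tr_add, Tr_add, Tr_Lop_zero]; ring

theorem TrM_one (hM : ∀ n, M (n + 1) = X * (P n + M n) + Lop n (M n)) :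
    Tr M 1 = X * Tr P 0 + ((X - 1) * Tr M 0 + Lop 0 (Tr M 0)) := by
  rw [Tr_succ, show (fun k => M (k + 1)) = fun k => (X * (P k + M k)) + Lop k (M k) from funext hM,
    Tr_add, Tr_mul, Tr_add, Tr_Lop_zero]; ring

theorem TrP_succ (hP : ∀ n, P (n + 1) = P n + M n + Lop n (P n)) (n : ℕ) :
    Tr P (n + 2) = Tr M (n + 1) + Lop (n + 1) (Tr P (n + 1))
      + ((2 * (n + 1) : ℕ) : Polynomial ℝ) * (X * Tr P n) := by
  rw [Tr_succ, show (fun k => P (k + 1)) = fun k => (P k + M k) + Lop k (P k) from funext hP,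
    Tr_add, Tr_add, Tr_Lop_succ]; push_cast; ring

theorem TrM_succ (hM : ∀ n, M (n + 1) = X * (P n + M n) + Lop n (M n)) (n : ℕ) :
    Tr M (n + 2) = X * Tr P (n + 1) + ((X - 1) * Tr M (n + 1) + Lop (n + 1) (Tr M (n + 1)))
      + ((2 * (n + 1) : ℕ) : Polynomial ℝ) * (X * Tr M n) := by
  rw [Tr_succ, show (fun k => M (k + 1)) = fun k => (X * (P k + M k)) + Lop k (M k) from funext hM,
    Tr_add, Tr_mul, Tr_add, Tr_Lop_succ]; push_cast; ring

theorem Pal_Tr (h0 : P 0 = 1) (h0' : M 0 = 0)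
    (hP : ∀ n, P (n + 1) = P n + M n + Lop n (P n))
    (hM : ∀ n, M (n + 1) = X * (P n + M n) + Lop n (M n)) (n : ℕ) :
    (Pal n (Tr P n) ∧ Pal (n + 1) (Tr M n)) ∧
      (Pal (n + 1) (Tr P (n + 1)) ∧ Pal (n + 2) (Tr M (n + 1))) := by
  induction n with
  | zero =>
    have a : Pal 0 (Tr P 0) := by
      rw [Tr_zero, h0]
      refine ⟨fun i j h => ?_, fun i h => ?_⟩
      · rw [show i = j by omega]
      · rw [coeff_one, if_neg (by omega)]
    have b : Pal 1 (Tr M 0) := by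
      rw [Tr_zero, h0']; exact ⟨fun i j h => by simp, fun i h => by simp⟩
    refine ⟨⟨a, b⟩, ?_, ?_⟩
    · rw [TrP_one hP]; exact b.add a.Lop
    · rw [TrM_one hM]; exact a.X_mul.add b.Lop'
  | succ n ih =>
    obtain ⟨⟨a, b⟩, c, d⟩ := ih
    refine ⟨⟨c, d⟩, ?_, ?_⟩
    · rw [TrP_succ hP]; exact (d.add c.Lop).add (a.X_mul.natMul _)
    · rw [TrM_succ hM]; exact (c.X_mul.add d.Lop').add (b.X_mul.natMul _)

theorem Tr_eq_d {d : ℕ → Polynomial ℝ} (h0 : P 0 = 1) (h0' : M 0 = 0)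
    (hP : ∀ n, P (n + 1) = P n + M n + Lop n (P n))
    (hM : ∀ n, M (n + 1) = X * (P n + M n) + Lop n (M n))
    (d0 : d 0 = 1) (d1 : d 1 = X)
    (hd : ∀ n, d (n + 2) = X * d (n + 1) + Lop (n + 1) (d (n + 1))
      + ((2 * (n + 1) : ℕ) : Polynomial ℝ) * (X * d n)) (n : ℕ) :
    d n = Tr P n + Tr M n ∧ d (n + 1) = Tr P (n + 1) + Tr M (n + 1) := by
  induction n with
  | zero =>
    refine ⟨by simp [Tr_zero, *], ?_⟩
    rw [TrP_one hP, TrM_one hM]; simp [Tr_zero, h0, h0', d1, Lop]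
  | succ n ih =>
    refine ⟨ih.2, ?_⟩
    rw [hd, TrP_succ hP, TrM_succ hM, ih.1, ih.2, Lop_add]; ring

end

theorem Pal_zero {n : ℕ} {h : Polynomial ℝ} (h1 : Pal n h) (h2 : Pal (n + 1) h) : h = 0 := by
  have key : ∀ k, k ≤ n + 1 → h.coeff k = 0 := by
    intro k
    induction k with
    | zero => intro _; rw [h2.1 0 (n + 1) (by omega)]; exact h1.2 _ (by omega)
    | succ k ih =>
      intro hk
      rw [h2.1 (k + 1) (n - k) (by omega), h1.1 (n - k) k (by omega)]
      exact ih (by omega)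
  ext k
  rcases Nat.lt_or_ge n k with hk | hk
  · simpa using h1.2 k hk
  · simpa using key k (by omega)

/-! ### Part B: words, and the recursion for descents -/

/-- the word with absolute values `σ` and signs `s` -/
def mkW {n : ℕ} (σ : Equiv.Perm (Fin n)) (s : Fin n → Bool) : Fin n → Fin n × Bool :=
  fun i => (σ i, s i)

theorem mkW_isSP {n : ℕ} (σ : Equiv.Perm (Fin n)) (s : Fin n → Bool) : IsSP (mkW σ s) :=
  σ.bijective

theorem sum_sp {n : ℕ} (Q : (Fin n → Fin n × Bool) → Prop) [DecidablePred Q]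
    (g : (Fin n → Fin n × Bool) → Polynomial ℝ) :
    ∑ u ∈ univ.filter (fun u : Fin n → Fin n × Bool => IsSP u ∧ Q u), g u
      = ∑ σ : Equiv.Perm (Fin n), ∑ s : Fin n → Bool,
          if Q (mkW σ s) then g (mkW σ s) else 0 := by
  rw [← Finset.filter_filter, Finset.sum_filter,
    ← Fintype.sum_prod_type' (fun (σ : Equiv.Perm (Fin n)) (s : Fin n → Bool) =>
      if Q (mkW σ s) then g (mkW σ s) else 0)]
  symm
  refine Finset.sum_nbij (fun x => mkW x.1 x.2) ?_ ?_ ?_ ?_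
  · intro x _; simp [mkW_isSP]
  · rintro ⟨σ, s⟩ _ ⟨τ, t⟩ _ h
    have h' : ∀ i, (σ i, s i) = (τ i, t i) := fun i => congrFun h i
    refine Prod.ext (Equiv.ext fun i => (Prod.ext_iff.1 (h' i)).1)
      (funext fun i => (Prod.ext_iff.1 (h' i)).2)
  · intro u hu
    have hu' : IsSP u := by simpa using hu
    exact ⟨(Equiv.ofBijective _ hu', fun i => (u i).2), by simp, funext fun i => rfl⟩
  · intro x _; rfl

/-- insert the largest value at position `p` -/
def insP {n : ℕ} (p : Fin (n + 1)) (σ : Equiv.Perm (Fin n)) : Equiv.Perm (Fin (n + 1)) :=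
  (finSuccEquiv' p).trans ((Equiv.optionCongr σ).trans (finSuccEquiv' (Fin.last n)).symm)

theorem insP_self {n : ℕ} (p : Fin (n + 1)) (σ : Equiv.Perm (Fin n)) :
    insP p σ p = Fin.last n := by simp [insP]

theorem insP_succAbove {n : ℕ} (p : Fin (n + 1)) (σ : Equiv.Perm (Fin n)) (i : Fin n) :
    insP p σ (p.succAbove i) = (σ i).castSucc := by simp [insP]

theorem insP_inj {n : ℕ} (p : Fin (n + 1)) : Function.Injective (insP p : Equiv.Perm (Fin n) → _) := by
  intro σ τ h
  ext i
  have := congrArg (fun e => e (p.succAbove i)) h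
  simp only [insP_succAbove] at this
  exact congrArg Fin.val (Fin.castSucc_injective _ this)

theorem sum_perm_of_inj {n : ℕ} (I : Fin (n + 1) → Equiv.Perm (Fin n) → Equiv.Perm (Fin (n + 1)))
    (h1 : ∀ p σ, I p σ p = Fin.last n) (h2 : ∀ p, Function.Injective (I p))
    (f : Equiv.Perm (Fin (n + 1)) → Polynomial ℝ) :
    ∑ τ, f τ = ∑ σ, ∑ p, f (I p σ) := by
  have hb : Function.Bijective (fun x : Fin (n + 1) × Equiv.Perm (Fin n) => I x.1 x.2) := by
    rw [Fintype.bijective_iff_injective_and_card]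
    refine ⟨?_, by simp [Fintype.card_perm, Nat.factorial_succ]⟩
    rintro ⟨p, σ⟩ ⟨q, τ⟩ h
    have h' : I p σ = I q τ := h
    have hpq : p = q := by
      apply (I p σ).injective
      rw [h1, h', h1]
    subst hpq
    rw [h2 p h']
  rw [← hb.sum_comp, Fintype.sum_prod_type, Finset.sum_comm]

theorem sum_insertNth {n : ℕ} (p : Fin (n + 1)) (f : (Fin (n + 1) → Bool) → Polynomial ℝ) :
    ∑ s, f s = ∑ s : Fin n → Bool, ∑ b : Bool, f (Fin.insertNth p b s) := by
  rw [← (Fin.insertNthEquiv (fun _ => Bool) p).sum_comp, Fintype.sum_prod_type, Finset.sum_comm]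
  rfl

/-- previous letter -/
def preL {n : ℕ} (c : Fin n → ℤ) (i : Fin n) : ℤ :=
  if (i : ℕ) = 0 then 0 else c ⟨(i : ℕ) - 1, by have := i.isLt; omega⟩

/-- descent indicator -/
def dI {n : ℕ} (c : Fin n → ℤ) (i : Fin n) : ℕ := if c i < preL c i then 1 else 0

/-- number of descents -/
def dsc {n : ℕ} (c : Fin n → ℤ) : ℕ := ∑ i, dI c i

theorem desB_eq {n : ℕ} (u : Fin n → Fin n × Bool) : desB u = dsc (letterW u) := by
  rw [desB, Finset.card_filter, dsc]
  refine Finset.sum_congr rfl fun i _ => ?_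
  by_cases h : (i : ℕ) = 0
  · simp [dI, preL, h]
  · simp [dI, preL, h, Nat.pos_of_ne_zero h]

theorem insNth_castSucc_lt {n : ℕ} (p : Fin (n + 1)) (M : ℤ) (c : Fin n → ℤ) (k : ℕ)
    (hk : k < n) (h : k < p) :
    (Fin.insertNth p M c : Fin (n + 1) → ℤ) ⟨k, by omega⟩ = c ⟨k, hk⟩ := by
  have : (⟨k, by omega⟩ : Fin (n + 1)) = p.succAbove ⟨k, hk⟩ := by
    rw [Fin.succAbove_of_castSucc_lt _ _ (by simpa [Fin.lt_def] using h)]; rfl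
  rw [this, Fin.insertNth_apply_succAbove]

theorem insNth_succ_ge {n : ℕ} (p : Fin (n + 1)) (M : ℤ) (c : Fin n → ℤ) (k : ℕ)
    (hk : k < n) (h : (p : ℕ) ≤ k) :
    (Fin.insertNth p M c : Fin (n + 1) → ℤ) ⟨k + 1, by omega⟩ = c ⟨k, hk⟩ := by
  have : (⟨k + 1, by omega⟩ : Fin (n + 1)) = p.succAbove ⟨k, hk⟩ := by
    rw [Fin.succAbove_of_le_castSucc _ _ (by simpa [Fin.le_def] using h)]; rfl
  rw [this, Fin.insertNth_apply_succAbove]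

theorem preL_ins_lt {n : ℕ} (p : Fin (n + 1)) (M : ℤ) (c : Fin n → ℤ) (i : Fin n)
    (h : (i : ℕ) ≤ p) : preL (Fin.insertNth p M c : Fin (n + 1) → ℤ) i.castSucc = preL c i := by
  unfold preL
  by_cases h0 : (i : ℕ) = 0
  · simp [h0]
  · have := i.isLt
    simp only [Fin.val_castSucc, h0, if_false]
    exact insNth_castSucc_lt p M c _ (by omega) (by omega)

theorem preL_ins_gt {n : ℕ} (p : Fin (n + 1)) (M : ℤ) (c : Fin n → ℤ) (i : Fin n)
    (h : (p : ℕ) < i) : preL (Fin.insertNth p M c : Fin (n + 1) → ℤ) i.succ = preL c i := by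
  unfold preL
  obtain ⟨i, hi⟩ := i
  cases i with
  | zero => simp at h
  | succ k =>
    simp only [Fin.val_succ, Nat.add_eq_zero_iff, one_ne_zero, and_false, if_false,
      Nat.add_sub_cancel]
    exact insNth_succ_ge p M c k (by omega) (by simpa [Nat.lt_succ_iff] using h)

theorem preL_ins_eq {n : ℕ} (q : Fin n) (M : ℤ) (c : Fin n → ℤ) :
    preL (Fin.insertNth q.castSucc M c : Fin (n + 1) → ℤ) q.succ = M := by
  unfold preL
  simp only [Fin.val_succ, Nat.add_eq_zero_iff, one_ne_zero, and_false, if_false,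
      Nat.add_sub_cancel]
  exact Fin.insertNth_apply_same (α := fun _ => ℤ) q.castSucc M c

theorem dI_ins {n : ℕ} (p : Fin (n + 1)) (M : ℤ) (c : Fin n → ℤ) (i : Fin n)
    (h : (i : ℕ) ≠ p) :
    dI (Fin.insertNth p M c : Fin (n + 1) → ℤ) (p.succAbove i) = dI c i := by
  unfold dI
  rw [Fin.insertNth_apply_succAbove]
  have : preL (Fin.insertNth p M c : Fin (n + 1) → ℤ) (p.succAbove i) = preL c i := by
    rcases Nat.lt_or_ge i p with h' | h'
    · rw [Fin.succAbove_of_castSucc_lt _ _ (by simpa [Fin.lt_def] using h')]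
      exact preL_ins_lt _ _ _ _ h'.le
    · rw [Fin.succAbove_of_le_castSucc _ _ (by simpa [Fin.le_def] using h')]
      exact preL_ins_gt _ _ _ _ (by omega)
  rw [this]

/-- `M` is larger in absolute value than all letters -/
def Big {n : ℕ} (M : ℤ) (c : Fin n → ℤ) : Prop :=
  (0 < M ∧ ∀ i, c i < M) ∨ (M < 0 ∧ ∀ i, M < c i)

theorem Big.pre {n : ℕ} {M : ℤ} {c : Fin n → ℤ} (h : Big M c) (i : Fin n) :
    (0 < M ∧ preL c i < M) ∨ (M < 0 ∧ M < preL c i) := by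
  unfold preL
  split_ifs
  · rcases h with h | h
    · exact Or.inl ⟨h.1, h.1⟩
    · exact Or.inr ⟨h.1, h.1⟩
  · rcases h with h | h
    · exact Or.inl ⟨h.1, h.2 _⟩
    · exact Or.inr ⟨h.1, h.2 _⟩

theorem dsc_ins_castSucc {n : ℕ} (q : Fin n) (M : ℤ) (c : Fin n → ℤ) (h : Big M c) :
    dsc (Fin.insertNth q.castSucc M c : Fin (n + 1) → ℤ) + dI c q = dsc c + 1 := by
  unfold dsc
  rw [Fin.sum_univ_succAbove _ q.castSucc, ← Finset.add_sum_erase univ _ (Finset.mem_univ q),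
    ← Finset.add_sum_erase univ (dI c) (Finset.mem_univ q)]
  have e : ∑ x ∈ univ.erase q, dI (Fin.insertNth q.castSucc M c : Fin (n + 1) → ℤ)
      (q.castSucc.succAbove x) = ∑ x ∈ univ.erase q, dI c x := by
    refine Finset.sum_congr rfl fun i hi => dI_ins _ _ _ _ ?_
    simpa [Fin.ext_iff] using hi
  rw [e]
  have k : dI (Fin.insertNth q.castSucc M c : Fin (n + 1) → ℤ) q.castSucc
      + dI (Fin.insertNth q.castSucc M c : Fin (n + 1) → ℤ) (q.castSucc.succAbove q) = 1 := by
    unfold dI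
    rw [Fin.insertNth_apply_succAbove, Fin.insertNth_apply_same,
      preL_ins_lt _ _ _ _ (le_of_eq rfl), Fin.succAbove_castSucc_self, preL_ins_eq]
    have h1 := h.pre q
    rcases h with h | h
    · have := h.2 q
      split_ifs <;> omega
    · have := h.2 q
      split_ifs <;> omega
  omega

theorem dsc_ins_last {n : ℕ} (M : ℤ) (c : Fin n → ℤ) (h : Big M c) :
    dsc (Fin.insertNth (Fin.last n) M c : Fin (n + 1) → ℤ) = dsc c + if M < 0 then 1 else 0 := by
  unfold dsc
  rw [Fin.sum_univ_succAbove _ (Fin.last n), add_comm]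
  congr 1
  · refine Finset.sum_congr rfl fun i hi => dI_ins _ _ _ _ ?_
    have := i.isLt
    simp only [Fin.val_last]; omega
  · unfold dI
    rw [Fin.insertNth_apply_same]
    have : (0 < M ∧ preL (Fin.insertNth (Fin.last n) M c : Fin (n + 1) → ℤ) (Fin.last n) < M) ∨
      (M < 0 ∧ M < preL (Fin.insertNth (Fin.last n) M c : Fin (n + 1) → ℤ) (Fin.last n)) := by
      unfold preL
      split_ifs with h0
      · rcases h with h | h
        · exact Or.inl ⟨h.1, h.1⟩
        · exact Or.inr ⟨h.1, h.1⟩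
      · simp only [Fin.val_last] at h0
        simp only [Fin.val_last]
        rw [insNth_castSucc_lt (Fin.last n) M c (n - 1) (by omega) (by simp only [Fin.val_last]; omega)]
        rcases h with h | h
        · exact Or.inl ⟨h.1, h.2 _⟩
        · exact Or.inr ⟨h.1, h.2 _⟩
    split_ifs <;> omega

/-- the signed integer with absolute value `k + 1` -/
def sg (b : Bool) (k : ℕ) : ℤ := if b then (k : ℤ) + 1 else -((k : ℤ) + 1)

theorem letterW_mkW {n : ℕ} (σ : Equiv.Perm (Fin n)) (s : Fin n → Bool) (i : Fin n) :
    letterW (mkW σ s) i = sg (s i) (σ i) := rfl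

theorem letterW_ins {n : ℕ} (p : Fin (n + 1)) (b : Bool) (σ : Equiv.Perm (Fin n))
    (s : Fin n → Bool) :
    letterW (mkW (insP p σ) (Fin.insertNth p b s))
      = Fin.insertNth p (sg b n) (letterW (mkW σ s)) := by
  rw [Fin.eq_insertNth_iff]
  constructor
  · rw [letterW_mkW, insP_self, Fin.insertNth_apply_same]; rfl
  · funext i
    rw [Fin.removeNth, letterW_mkW, insP_succAbove, Fin.insertNth_apply_succAbove, letterW_mkW]; rfl

theorem big_letter {n : ℕ} (b : Bool) (σ : Equiv.Perm (Fin n)) (s : Fin n → Bool) :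
    Big (sg b n) (letterW (mkW σ s)) := by
  have : ∀ i, -((n : ℤ) + 1) < letterW (mkW σ s) i ∧ letterW (mkW σ s) i < (n : ℤ) + 1 := by
    intro i
    have := (σ i).isLt
    rw [letterW_mkW, sg]
    split_ifs <;> omega
  cases b
  · right; refine ⟨by simp only [sg, Bool.false_eq_true, if_false]; omega, fun i => ?_⟩
    simpa [sg] using (this i).1
  · left; refine ⟨by simp only [sg, if_true]; omega, fun i => ?_⟩
    simpa [sg] using (this i).2

/-- the last letter (if any) is positive -/
def posC {n : ℕ} (c : Fin n → ℤ) : Prop := ∀ i : Fin n, (i : ℕ) + 1 = n → 0 < c i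

theorem posC_last {n : ℕ} (c : Fin (n + 1) → ℤ) : posC c ↔ 0 < c (Fin.last n) := by
  constructor
  · intro h; exact h _ (by simp)
  · intro h i hi
    have : i = Fin.last n := Fin.ext (by simpa using hi)
    rwa [this]

theorem posC_ins_last {n : ℕ} (M : ℤ) (c : Fin n → ℤ) :
    posC (Fin.insertNth (Fin.last n) M c : Fin (n + 1) → ℤ) ↔ 0 < M := by
  rw [posC_last, Fin.insertNth_apply_same]

theorem posC_ins_castSucc {n : ℕ} (q : Fin n) (M : ℤ) (c : Fin n → ℤ) :
    posC (Fin.insertNth q.castSucc M c : Fin (n + 1) → ℤ) ↔ posC c := by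
  cases n with
  | zero => exact q.elim0
  | succ m =>
    rw [posC_last, posC_last]
    have := insNth_succ_ge q.castSucc M c m (by omega) (by have := q.isLt; simp; omega)
    have e : (Fin.last (m + 1)) = ⟨m + 1, by omega⟩ := rfl
    rw [e, this]; rfl

open Classical in
theorem Bplus_eq (n : ℕ) : Bplus n = ∑ σ : Equiv.Perm (Fin n), ∑ s : Fin n → Bool,
    if posC (letterW (mkW σ s)) then X ^ dsc (letterW (mkW σ s)) else 0 := by
  cases n with
  | zero => simp [Bplus, posC, dsc]
  | succ n =>
    rw [Bplus, sum_sp]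
    refine Finset.sum_congr rfl fun σ _ => Finset.sum_congr rfl fun s _ => ?_
    simp only [posC_last, desB_eq]

open Classical in
theorem Bminus_eq (n : ℕ) : Bminus n = ∑ σ : Equiv.Perm (Fin n), ∑ s : Fin n → Bool,
    if ¬ posC (letterW (mkW σ s)) then X ^ dsc (letterW (mkW σ s)) else 0 := by
  cases n with
  | zero => simp [Bminus, posC]
  | succ n =>
    rw [Bminus, sum_sp]
    refine Finset.sum_congr rfl fun σ _ => Finset.sum_congr rfl fun s _ => ?_
    have : letterW (mkW σ s) (Fin.last n) < 0 ↔ ¬ 0 < letterW (mkW σ s) (Fin.last n) := by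
      rw [letterW_mkW, sg]; split_ifs <;> omega
    simp only [posC_last, desB_eq, this]

theorem Lop_zero (n : ℕ) : Lop n 0 = 0 := by simp [Lop]

theorem Lop_sum {ι : Type*} (n : ℕ) (t : Finset ι) (f : ι → Polynomial ℝ) :
    Lop n (∑ i ∈ t, f i) = ∑ i ∈ t, Lop n (f i) := by
  simp only [Lop, derivative_sum, Finset.mul_sum, Finset.sum_add_distrib]

theorem Lop_X_pow (n d : ℕ) : Lop n (X ^ d)
    = 2 * ((n : Polynomial ℝ) * X ^ (d + 1) + (d : Polynomial ℝ) * (X ^ d - X ^ (d + 1))) := by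
  rw [Lop, derivative_X_pow]
  cases d with
  | zero => simp; ring
  | succ d => simp; ring

theorem dI_le {n : ℕ} (c : Fin n → ℤ) (i : Fin n) : dI c i = 0 ∨ dI c i = 1 := by
  unfold dI; split_ifs <;> simp

theorem X_pow_dsc_ins {n : ℕ} (q : Fin n) (M : ℤ) (c : Fin n → ℤ) (h : Big M c) :
    (X : Polynomial ℝ) ^ dsc (Fin.insertNth q.castSucc M c : Fin (n + 1) → ℤ)
      = X ^ (dsc c + 1) + (dI c q : Polynomial ℝ) * (X ^ dsc c - X ^ (dsc c + 1)) := by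
  have := dsc_ins_castSucc q M c h
  rcases dI_le c q with h | h <;> rw [h] at this ⊢
  · rw [show dsc (Fin.insertNth q.castSucc M c : Fin (n + 1) → ℤ) = dsc c + 1 by omega]; simp
  · rw [show dsc (Fin.insertNth q.castSucc M c : Fin (n + 1) → ℤ) = dsc c by omega]; simp

open Classical in
theorem inner_des {n : ℕ} (σ : Equiv.Perm (Fin n)) (s : Fin n → Bool) (g : Prop → Prop)
    (hg : (g True ∧ ¬ g False) ∨ (¬ g True ∧ g False)) :
    ∑ p : Fin (n + 1), ∑ b : Bool,
      (if g (posC (letterW (mkW (insP p σ) (Fin.insertNth p b s)))) then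
        (X : Polynomial ℝ) ^ dsc (letterW (mkW (insP p σ) (Fin.insertNth p b s))) else 0)
    = (if g True then 1 else X) * X ^ dsc (letterW (mkW σ s)) +
      Lop n (if g (posC (letterW (mkW σ s))) then X ^ dsc (letterW (mkW σ s)) else 0) := by
  have hi : ∀ (q : Fin n) (b : Bool), posC (Fin.insertNth q.castSucc (sg b n)
      (letterW (mkW σ s)) : Fin (n + 1) → ℤ) = posC (letterW (mkW σ s)) :=
    fun q b => propext (posC_ins_castSucc q _ _)
  have hl : ∀ (b : Bool), posC (Fin.insertNth (Fin.last n) (sg b n)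
      (letterW (mkW σ s)) : Fin (n + 1) → ℤ) = (b = true) := by
    intro b
    rw [posC_ins_last]
    cases b
    · simp [sg]
      try omega
    · simp [sg]
      try omega
  simp only [letterW_ins]
  rw [Fin.sum_univ_castSucc, add_comm]
  congr 1
  · simp only [hl, dsc_ins_last _ _ (big_letter _ σ s), Fintype.sum_bool]
    have e1 : ¬ (sg true n < 0) := by simp [sg]; omega
    have e2 : (sg false n < 0) := by simp [sg]; omega
    rcases hg with hg | hg
    · simp [hg, e1]
    · simp [hg, e2, pow_succ, mul_comm]
  · simp only [hi]
    by_cases hp : g (posC (letterW (mkW σ s)))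
    · simp only [hp, if_true, X_pow_dsc_ins _ _ _ (big_letter _ σ s), Fintype.sum_bool]
      rw [Lop_X_pow, Finset.sum_add_distrib, Finset.sum_add_distrib, ← Finset.sum_mul,
        ← Nat.cast_sum]
      change _ + (dsc _ : Polynomial ℝ) * _ + (_ + (dsc _ : Polynomial ℝ) * _) = _
      simp; ring
    · simp [hp, Lop_zero]

open Classical in
theorem sum_rec (n : ℕ) (g : Prop → Prop)
    (hg : (g True ∧ ¬ g False) ∨ (¬ g True ∧ g False)) :
    (∑ σ : Equiv.Perm (Fin (n + 1)), ∑ s : Fin (n + 1) → Bool,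
      if g (posC (letterW (mkW σ s))) then (X : Polynomial ℝ) ^ dsc (letterW (mkW σ s)) else 0)
    = (if g True then 1 else X) * (Bplus n + Bminus n)
      + Lop n (∑ σ : Equiv.Perm (Fin n), ∑ s : Fin n → Bool,
      if g (posC (letterW (mkW σ s))) then (X : Polynomial ℝ) ^ dsc (letterW (mkW σ s)) else 0) := by
  rw [sum_perm_of_inj insP insP_self insP_inj]
  have : Bplus n + Bminus n = ∑ σ : Equiv.Perm (Fin n), ∑ s : Fin n → Bool,
      (X : Polynomial ℝ) ^ dsc (letterW (mkW σ s)) := by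
    rw [Bplus_eq, Bminus_eq, ← Finset.sum_add_distrib]
    refine Finset.sum_congr rfl fun σ _ => ?_
    rw [← Finset.sum_add_distrib]
    refine Finset.sum_congr rfl fun s _ => ?_
    by_cases h : posC (letterW (mkW σ s)) <;> simp [h]
  rw [this, Lop_sum, Finset.mul_sum, ← Finset.sum_add_distrib]
  refine Finset.sum_congr rfl fun σ _ => ?_
  rw [Lop_sum, Finset.mul_sum, ← Finset.sum_add_distrib]
  rw [Finset.sum_congr rfl fun p _ => sum_insertNth p _, Finset.sum_comm]
  exact Finset.sum_congr rfl fun s _ => inner_des σ s g hg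

theorem Bplus_rec (n : ℕ) : Bplus (n + 1) = Bplus n + Bminus n + Lop n (Bplus n) := by
  have := sum_rec n (fun P => P) (by simp)
  simp only [if_true, one_mul] at this
  rw [Bplus_eq (n + 1), this, ← Bplus_eq]

theorem Bminus_rec (n : ℕ) : Bminus (n + 1) = X * (Bplus n + Bminus n) + Lop n (Bminus n) := by
  have := sum_rec n (fun P => ¬ P) (by simp)
  simp only [not_true, if_false] at this
  rw [Bminus_eq (n + 1), congrArg (Lop n) (Bminus_eq n)]
  convert this

/-! ### Part C: the recursion for excedances -/

/-- excedance indicator -/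
def eI {n : ℕ} (σ : Equiv.Perm (Fin n)) (ε : Fin n → Bool) (k : Fin n) : ℕ :=
  if sg (ε k) k < sg (ε (σ k)) (σ k) ∨ (ε k = false ∧ σ k = k) then 1 else 0

/-- positive fixed point indicator -/
def fI {n : ℕ} (σ : Equiv.Perm (Fin n)) (ε : Fin n → Bool) (k : Fin n) : ℕ :=
  if σ k = k ∧ ε k = true then 1 else 0

/-- number of excedances -/
def exS {n : ℕ} (σ : Equiv.Perm (Fin n)) (ε : Fin n → Bool) : ℕ := ∑ k, eI σ ε k

/-- number of positive fixed points -/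
def fxS {n : ℕ} (σ : Equiv.Perm (Fin n)) (ε : Fin n → Bool) : ℕ := ∑ k, fI σ ε k

theorem sg_inj {a b : Bool} {k l : ℕ} (h : sg a k = sg b l) : k = l := by
  unfold sg at h; split_ifs at h <;> omega

theorem aVal_mkW {n : ℕ} (σ : Equiv.Perm (Fin n)) (ε : Fin n → Bool) (k : Fin n) :
    aVal (mkW σ (fun i => ε (σ i))) k = sg (ε k) k := by
  have : (∃ j, mkW σ (fun i => ε (σ i)) j = (k, true)) ↔ ε k = true := by
    simp only [mkW, Prod.mk.injEq]
    constructor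
    · rintro ⟨j, rfl, h⟩; exact h
    · intro h; exact ⟨σ.symm k, by simp, by simpa using h⟩
  simp only [aVal, this, sg]

theorem sg_neg_iff (b : Bool) (k : ℕ) : sg b k < 0 ↔ b = false := by
  unfold sg; cases b <;> simp only [Bool.false_eq_true, if_false, if_true] <;> grind

theorem sg_pos_iff (b : Bool) (k : ℕ) : 0 < sg b k ↔ b = true := by
  unfold sg; cases b <;> simp only [Bool.false_eq_true, if_false, if_true] <;> grind

theorem sg_eq_iff {n : ℕ} (σ : Equiv.Perm (Fin n)) (ε : Fin n → Bool) (k : Fin n) :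
    sg (ε (σ k)) (σ k) = sg (ε k) k ↔ σ k = k :=
  ⟨fun h => Fin.ext (sg_inj h), fun h => by rw [h]⟩

theorem excB_eq {n : ℕ} (σ : Equiv.Perm (Fin n)) (ε : Fin n → Bool) :
    excB (mkW σ (fun i => ε (σ i))) = exS σ ε := by
  rw [excB, Finset.card_filter, exS]
  refine Finset.sum_congr rfl fun k _ => ?_
  simp only [aVal_mkW, letterW_mkW, sg_neg_iff, sg_eq_iff, eI]

theorem isDerB_iff {n : ℕ} (σ : Equiv.Perm (Fin n)) (ε : Fin n → Bool) :
    IsDerB (mkW σ (fun i => ε (σ i))) ↔ fxS σ ε = 0 := by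
  simp only [IsDerB, aVal_mkW, letterW_mkW, sg_pos_iff, ne_eq, sg_eq_iff, fxS,
    Finset.sum_eq_zero_iff, Finset.mem_univ, true_imp_iff, fI, ite_eq_right_iff, one_ne_zero,
    imp_false, not_and]
  exact forall_congr' fun k => ⟨fun h a b => h b a, fun h a b => h b a⟩

/-- excedance enumerator of signed permutations with `j` positive fixed points -/
noncomputable def ev (n j : ℕ) : Polynomial ℝ :=
  ∑ σ : Equiv.Perm (Fin n), ∑ ε : Fin n → Bool, if fxS σ ε = j then X ^ exS σ ε else 0

theorem dB_eq (n : ℕ) : dB n = ev n 0 := by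
  rw [dB, sum_sp, ev]
  refine Finset.sum_congr rfl fun σ _ => ?_
  rw [← (Equiv.arrowCongr σ.symm (Equiv.refl Bool)).sum_comp]
  refine Finset.sum_congr rfl fun ε _ => ?_
  have : (Equiv.arrowCongr σ.symm (Equiv.refl Bool)) ε = fun i => ε (σ i) := by
    funext i; simp [Equiv.arrowCongr]
  rw [this, excB_eq]
  simp only [isDerB_iff]

/-- insert the largest element into the cycle, after `p` -/
def insC {n : ℕ} (p : Fin (n + 1)) (σ : Equiv.Perm (Fin n)) : Equiv.Perm (Fin (n + 1)) :=
  (Equiv.swap p (Fin.last n)).trans (insP (Fin.last n) σ)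

theorem insC_self {n : ℕ} (p : Fin (n + 1)) (σ : Equiv.Perm (Fin n)) :
    insC p σ p = Fin.last n := by simp [insC, insP_self]

theorem insC_inj {n : ℕ} (p : Fin (n + 1)) : Function.Injective (insC p : Equiv.Perm (Fin n) → _) := by
  intro σ τ h
  apply insP_inj (Fin.last n)
  ext i
  have := congrArg (fun e => e (Equiv.swap p (Fin.last n) i)) h
  simp only [insC, Equiv.trans_apply, Equiv.swap_apply_self] at this
  rw [this]

theorem insP_last_castSucc {n : ℕ} (σ : Equiv.Perm (Fin n)) (i : Fin n) :
    insP (Fin.last n) σ i.castSucc = (σ i).castSucc := by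
  have := insP_succAbove (Fin.last n) σ i
  rwa [Fin.succAbove_last] at this

theorem insC_last {n : ℕ} (q : Fin n) (σ : Equiv.Perm (Fin n)) :
    insC q.castSucc σ (Fin.last n) = (σ q).castSucc := by
  simp [insC, insP_last_castSucc]

theorem insC_ne {n : ℕ} (q i : Fin n) (σ : Equiv.Perm (Fin n)) (h : i ≠ q) :
    insC q.castSucc σ i.castSucc = (σ i).castSucc := by
  rw [insC, Equiv.trans_apply, Equiv.swap_apply_of_ne_of_ne, insP_last_castSucc]
  · simpa using h
  · exact (Fin.castSucc_lt_last i).ne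

theorem insC_last_castSucc {n : ℕ} (i : Fin n) (σ : Equiv.Perm (Fin n)) :
    insC (Fin.last n) σ i.castSucc = (σ i).castSucc := by
  simp [insC, insP_last_castSucc]

theorem sgn_castSucc {n : ℕ} (b : Bool) (ε : Fin n → Bool) (i : Fin n) :
    (Fin.insertNth (Fin.last n) b ε : Fin (n + 1) → Bool) i.castSucc = ε i := by
  have := Fin.insertNth_apply_succAbove (α := fun _ => Bool) (Fin.last n) b ε i
  rwa [Fin.succAbove_last] at this

theorem sgn_last {n : ℕ} (b : Bool) (ε : Fin n → Bool) :
    (Fin.insertNth (Fin.last n) b ε : Fin (n + 1) → Bool) (Fin.last n) = b :=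
  Fin.insertNth_apply_same (α := fun _ => Bool) (Fin.last n) b ε

theorem exS_last {n : ℕ} (σ : Equiv.Perm (Fin n)) (ε : Fin n → Bool) (b : Bool) :
    exS (insC (Fin.last n) σ) (Fin.insertNth (Fin.last n) b ε) = exS σ ε + if b then 0 else 1 := by
  rw [exS, Fin.sum_univ_castSucc]
  simp only [eI, insC_last_castSucc, insC_self, sgn_castSucc, sgn_last, Fin.val_castSucc,
    Fin.castSucc_inj, exS]
  cases b <;> simp

theorem fxS_last {n : ℕ} (σ : Equiv.Perm (Fin n)) (ε : Fin n → Bool) (b : Bool) :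
    fxS (insC (Fin.last n) σ) (Fin.insertNth (Fin.last n) b ε) = fxS σ ε + if b then 1 else 0 := by
  rw [fxS, Fin.sum_univ_castSucc]
  simp only [fI, insC_last_castSucc, insC_self, sgn_castSucc, sgn_last,
    Fin.castSucc_inj, fxS]
  cases b <;> simp

theorem exS_castSucc {n : ℕ} (q : Fin n) (σ : Equiv.Perm (Fin n)) (ε : Fin n → Bool) (b : Bool) :
    exS (insC q.castSucc σ) (Fin.insertNth (Fin.last n) b ε) + eI σ ε q = exS σ ε + 1 := by
  rw [exS, Fin.sum_univ_castSucc, exS, ← Finset.add_sum_erase univ _ (Finset.mem_univ q),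
    ← Finset.add_sum_erase univ (eI σ ε) (Finset.mem_univ q)]
  have e : ∑ x ∈ univ.erase q, eI (insC q.castSucc σ)
      (Fin.insertNth (Fin.last n) b ε) x.castSucc = ∑ x ∈ univ.erase q, eI σ ε x := by
    refine Finset.sum_congr rfl fun i hi => ?_
    have hi' : i ≠ q := by simpa using hi
    simp only [eI, insC_ne q i σ hi', sgn_castSucc, Fin.val_castSucc, Fin.castSucc_inj]
  have k : eI (insC q.castSucc σ) (Fin.insertNth (Fin.last n) b ε) q.castSucc
      + eI (insC q.castSucc σ) (Fin.insertNth (Fin.last n) b ε) (Fin.last n) = 1 := by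
    simp only [eI, insC_self, insC_last, sgn_castSucc, sgn_last, Fin.val_castSucc, Fin.val_last,
      (Fin.castSucc_lt_last _).ne, (Fin.castSucc_lt_last _).ne', and_false, or_false]
    have h1 := q.isLt
    have h2 := (σ q).isLt
    have hA : ∀ (a : Bool) (m : ℕ), m < n → -((n : ℤ) + 1) < sg a m ∧ sg a m < (n : ℤ) + 1 := by
      intro a m hm; unfold sg; split_ifs <;> omega
    have a1 := hA (ε q) q h1
    have a2 := hA (ε (σ q)) (σ q) h2
    have a3 : sg b n = (n : ℤ) + 1 ∨ sg b n = -((n : ℤ) + 1) := by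
      unfold sg; split_ifs <;> simp
    split_ifs <;> omega
  rw [e]
  omega

theorem fxS_castSucc {n : ℕ} (q : Fin n) (σ : Equiv.Perm (Fin n)) (ε : Fin n → Bool) (b : Bool) :
    fxS (insC q.castSucc σ) (Fin.insertNth (Fin.last n) b ε) + fI σ ε q = fxS σ ε := by
  rw [fxS, Fin.sum_univ_castSucc, fxS, ← Finset.add_sum_erase univ _ (Finset.mem_univ q),
    ← Finset.add_sum_erase univ (fI σ ε) (Finset.mem_univ q)]
  have e : ∑ x ∈ univ.erase q, fI (insC q.castSucc σ)
      (Fin.insertNth (Fin.last n) b ε) x.castSucc = ∑ x ∈ univ.erase q, fI σ ε x := by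
    refine Finset.sum_congr rfl fun i hi => ?_
    have hi' : i ≠ q := by simpa using hi
    simp only [fI, insC_ne q i σ hi', sgn_castSucc, Fin.castSucc_inj]
  have k : fI (insC q.castSucc σ) (Fin.insertNth (Fin.last n) b ε) q.castSucc
      + fI (insC q.castSucc σ) (Fin.insertNth (Fin.last n) b ε) (Fin.last n) = 0 := by
    simp [fI, insC_self, insC_last, (Fin.castSucc_lt_last _).ne, (Fin.castSucc_lt_last _).ne']
  rw [e]
  omega

theorem ind_cases {n : ℕ} (σ : Equiv.Perm (Fin n)) (ε : Fin n → Bool) (q : Fin n) :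
    (eI σ ε q = 0 ∧ fI σ ε q = 0) ∨ (eI σ ε q = 1 ∧ fI σ ε q = 0) ∨
      (eI σ ε q = 0 ∧ fI σ ε q = 1) := by
  by_cases h : σ q = q ∧ ε q = true
  · right; right; simp [eI, fI, h]
  · have : fI σ ε q = 0 := by simp [fI, h]
    rw [this]
    unfold eI; split_ifs <;> simp

theorem term_castSucc {n : ℕ} (j : ℕ) (q : Fin n) (σ : Equiv.Perm (Fin n)) (ε : Fin n → Bool)
    (b : Bool) :
    (if fxS (insC q.castSucc σ) (Fin.insertNth (Fin.last n) b ε) = j then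
      (X : Polynomial ℝ) ^ exS (insC q.castSucc σ) (Fin.insertNth (Fin.last n) b ε) else 0)
    = (if fxS σ ε = j then (X : Polynomial ℝ) ^ (exS σ ε + 1) else 0)
      + (eI σ ε q : Polynomial ℝ) *
        (if fxS σ ε = j then X ^ exS σ ε - X ^ (exS σ ε + 1) else 0)
      - (fI σ ε q : Polynomial ℝ) * (if fxS σ ε = j then X ^ (exS σ ε + 1) else 0)
      + (fI σ ε q : Polynomial ℝ) * (if fxS σ ε = j + 1 then X ^ (exS σ ε + 1) else 0) := by
  have h1 := exS_castSucc q σ ε b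
  have h2 := fxS_castSucc q σ ε b
  generalize exS (insC q.castSucc σ) (Fin.insertNth (Fin.last n) b ε) = a' at *
  generalize fxS (insC q.castSucc σ) (Fin.insertNth (Fin.last n) b ε) = f' at *
  rcases ind_cases σ ε q with ⟨h, h'⟩ | ⟨h, h'⟩ | ⟨h, h'⟩ <;> rw [h] at h1 <;> rw [h'] at h2 <;>
    rw [h, h']
  · rw [show a' = exS σ ε + 1 by omega, show f' = fxS σ ε by omega]; simp
  · rw [show a' = exS σ ε by omega, show f' = fxS σ ε by omega]
    by_cases hj : fxS σ ε = j <;> simp [hj]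
  · rw [show a' = exS σ ε + 1 by omega, ← h2]; simp

theorem inner_exc {n : ℕ} (j : ℕ) (σ : Equiv.Perm (Fin n)) (ε : Fin n → Bool) :
    ∑ p : Fin (n + 1), ∑ b : Bool,
      (if fxS (insC p σ) (Fin.insertNth (Fin.last n) b ε) = j then
        (X : Polynomial ℝ) ^ exS (insC p σ) (Fin.insertNth (Fin.last n) b ε) else 0)
    = (if fxS σ ε + 1 = j then X ^ exS σ ε else 0)
      + X * (if fxS σ ε = j then X ^ exS σ ε else 0)
      + Lop n (if fxS σ ε = j then X ^ exS σ ε else 0)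
      - 2 * (j : Polynomial ℝ) * X * (if fxS σ ε = j then X ^ exS σ ε else 0)
      + 2 * ((j : Polynomial ℝ) + 1) * X * (if fxS σ ε = j + 1 then X ^ exS σ ε else 0) := by
  rw [Fin.sum_univ_castSucc]
  simp only [term_castSucc, Fintype.sum_bool, exS_last, fxS_last, Finset.sum_add_distrib,
    Finset.sum_sub_distrib, ← Finset.sum_mul, ← Nat.cast_sum]
  have h1 : ∑ i, eI σ ε i = exS σ ε := rfl
  have h2 : ∑ i, fI σ ε i = fxS σ ε := rfl
  rw [h1, h2]
  by_cases hj : fxS σ ε = j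
  · have hn : ¬ (j = j + 1) := by omega
    have hn' : ¬ (j + 1 = j) := by omega
    simp only [hj, if_true, Lop_X_pow, hn, hn', if_false]
    simp; ring
  · by_cases hj' : fxS σ ε = j + 1
    · have hn : ¬ (j + 1 = j) := by omega
      have hn' : ¬ (j + 1 + 1 = j) := by omega
      simp only [hj', if_true, Lop_zero, hn, hn', if_false]
      simp; ring
    · simp only [hj, hj', if_false, Lop_zero]
      simp [hj]

/-- the term `ev n (j - 1)`, read as zero for `j = 0` -/
noncomputable def evp (n : ℕ) : ℕ → Polynomial ℝ
  | 0 => 0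
  | j + 1 => ev n j

theorem evp_eq (n j : ℕ) : evp n j = ∑ σ : Equiv.Perm (Fin n), ∑ ε : Fin n → Bool,
    if fxS σ ε + 1 = j then X ^ exS σ ε else 0 := by
  cases j with
  | zero => simp [evp]
  | succ j => simp [evp, ev]

theorem ev_rec (n j : ℕ) : ev (n + 1) j = evp n j + X * ev n j + Lop n (ev n j)
    - 2 * (j : Polynomial ℝ) * X * ev n j + 2 * ((j : Polynomial ℝ) + 1) * X * ev n (j + 1) := by
  rw [evp_eq, ev, sum_perm_of_inj insC insC_self insC_inj]
  simp only [ev, Lop_sum, Finset.mul_sum, ← Finset.sum_add_distrib, ← Finset.sum_sub_distrib]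
  refine Finset.sum_congr rfl fun σ _ => ?_
  rw [Finset.sum_congr rfl fun p _ => sum_insertNth (Fin.last n) _, Finset.sum_comm]
  exact Finset.sum_congr rfl fun ε _ => inner_exc j σ ε

theorem ev_zero_zero : ev 0 0 = 1 := by
  simp [ev, fxS, exS]

theorem ev_zero_succ (j : ℕ) : ev 0 (j + 1) = 0 := by
  simp [ev, fxS]

theorem Lop_natMul (n m : ℕ) (a : Polynomial ℝ) :
    Lop n ((m : Polynomial ℝ) * a) = (m : Polynomial ℝ) * Lop n a := by
  simp only [Lop, derivative_mul, derivative_natCast]; ring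

theorem Lop_succ (n : ℕ) (a : Polynomial ℝ) : Lop (n + 1) a = Lop n a + 2 * X * a := by
  simp only [Lop]; push_cast; ring

theorem ev_fix (n : ℕ) : ∀ j, ((j + 1 : ℕ) : Polynomial ℝ) * ev (n + 1) (j + 1)
    = ((n + 1 : ℕ) : Polynomial ℝ) * ev n j := by
  induction n with
  | zero =>
    intro j
    rw [ev_rec, ev_zero_succ, ev_zero_succ, Lop_zero]
    cases j with
    | zero => simp [evp]
    | succ j => simp [evp, ev_zero_succ]
  | succ n ih =>
    intro j
    have hp : (j : Polynomial ℝ) * ev (n + 1) j = ((n + 1 : ℕ) : Polynomial ℝ) * evp n j := by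
      cases j with
      | zero => simp [evp]
      | succ j => exact ih j
    have h1 := ih j
    have h2 := ih (j + 1)
    have h3 := ev_rec n j
    have hL := congrArg (Lop (n + 1)) h1
    rw [Lop_natMul, Lop_natMul, Lop_succ n (ev n j)] at hL
    rw [ev_rec (n + 1) (j + 1), evp]
    push_cast at *
    linear_combination hL + (X - 2 * ((j : Polynomial ℝ) + 1) * X) * h1
      + 2 * ((j : Polynomial ℝ) + 1) * X * h2 - ((n : Polynomial ℝ) + 1) * h3 + hp

theorem dB_zero : dB 0 = 1 := by rw [dB_eq, ev_zero_zero]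

theorem dB_one : dB 1 = X := by
  rw [dB_eq, ev_rec, ev_zero_zero, ev_zero_succ]; simp [evp, Lop]

theorem dB_rec (n : ℕ) : dB (n + 2) = X * dB (n + 1) + Lop (n + 1) (dB (n + 1))
      + ((2 * (n + 1) : ℕ) : Polynomial ℝ) * (X * dB n) := by
  have h := ev_fix n 0
  rw [dB_eq, dB_eq, dB_eq, ev_rec, evp]
  push_cast at *
  linear_combination 2 * X * h

/-- `f_n^+(x) = Σ_{k=0}^n (−1)^{n−k} (n choose k) B_k^+(x)`. -/
theorem fplus_eq_alternating_sum_Bplus (n : ℕ)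
    (fp fm : Polynomial ℝ)
    (hsum : dB n = fp + fm)
    (hpdeg : fp.degree ≤ (n : WithBot ℕ))
    (hpsymm : ∀ k ≤ n, fp.coeff k = fp.coeff (n - k))
    (hmdeg : fm.degree ≤ ((n + 1 : ℕ) : WithBot ℕ))
    (hmsymm : ∀ k ≤ n + 1, fm.coeff k = fm.coeff (n + 1 - k))
    :
    fp = ∑ k ∈ Finset.range (n + 1),
      (-1 : Polynomial ℝ) ^ (n - k) * (n.choose k : Polynomial ℝ) * Bplus k := by
  have hpal := (Pal_Tr (P := Bplus) (M := Bminus) rfl rfl Bplus_rec Bminus_rec n).1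
  have hd := (Tr_eq_d (P := Bplus) (M := Bminus) rfl rfl Bplus_rec Bminus_rec
    dB_zero dB_one dB_rec n).1
  change fp = Tr Bplus n
  have hfp : Pal n fp := by
    refine ⟨fun i j h => ?_, fun i h => ?_⟩
    · rw [hpsymm i (by omega), show n - i = j by omega]
    · exact coeff_eq_zero_of_degree_lt (lt_of_le_of_lt hpdeg (by exact_mod_cast h))
  have hfm : Pal (n + 1) fm := by
    refine ⟨fun i j h => ?_, fun i h => ?_⟩
    · rw [hmsymm i (by omega), show n + 1 - i = j by omega]
    · exact coeff_eq_zero_of_degree_lt (lt_of_le_of_lt hmdeg (by exact_mod_cast h))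
  have h1 : Pal n (fp - Tr Bplus n) :=
    ⟨fun i j h => by simp [hfp.1 i j h, hpal.1.1 i j h],
      fun i h => by simp [hfp.2 i h, hpal.1.2 i h]⟩
  have h2 : Pal (n + 1) (Tr Bminus n - fm) :=
    ⟨fun i j h => by simp [hfm.1 i j h, hpal.2.1 i j h],
      fun i h => by simp [hfm.2 i h, hpal.2.2 i h]⟩
  have e : Tr Bminus n - fm = fp - Tr Bplus n := by
    linear_combination hsum - hd
  rw [e] at h2
  exact sub_eq_zero.1 (Pal_zero h1 h2)
end

section
/- For every natural number n, define ξ_n^+(x) = Σ (n choose r_0, r_1, …, r_{2k}) x^k ξ_{r_0}(x) γ_{r_1}(x) ⋯ γ_{r_{2k}}(x) and ξ_n^-(x) = Σ (n choose r_0, r_1, …, r_{2k+1}) x^{k+1} ξ_{r_0}(x) γ_{r_1}(x) ⋯ γ_{r_{2k+1}}(x), where the sums range over all k ∈ ℕ and all sequences of nonnegative integers (r_0, …, r_{2k}), respectively (r_0, …, r_{2k+1}), summing to n, with the conventions ξ_0(x) = 1 and γ_0(x) = 0. Then f_n^+(x) = (1+x)^n ξ_n^+(x/(1+x)^2) and f_n^-(x)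 = (1+x)^{n+1} ξ_n^-(x/(1+x)^2). -/
open Polynomial Finset

/-- the rational function `x/(1+x)²` -/
noncomputable def yRat : RatFunc ℝ := RatFunc.X / (1 + RatFunc.X) ^ 2

lemma dA_transport {β : Type} [Fintype β] [DecidableEq β] (v : β → ℤ)
    (hv : Function.Injective v) (x : ℝ) (m : ℕ) (hm : Fintype.card β = m) :
    ∑ w ∈ univ.filter (fun w : Equiv.Perm β => ∀ i, w i ≠ i),
      x ^ (univ.filter fun i : β => v i < v (w i)).card = (dA m).eval x := by
  let inst : LinearOrder β := LinearOrder.lift' v hv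
  obtain ⟨e⟩ : Nonempty (Fin m ≃o β) := ⟨Fintype.orderIsoFinOfCardEq β hm⟩
  have he : ∀ i j, v (e i) < v (e j) ↔ i < j := fun i j => e.lt_iff_lt
  unfold dA
  rw [Polynomial.eval_finsetSum]
  symm
  refine Finset.sum_equiv (Equiv.permCongr e.toEquiv) ?_ ?_
  · intro w
    simp only [mem_filter, mem_univ, true_and]
    constructor
    · intro h i hi
      apply h (e.symm i)
      apply e.injective
      simpa using hi
    · intro h i hi
      apply h (e i)
      simp [hi]
  · intro w _
    simp only [eval_pow, eval_X, excA]
    congr 1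
    refine Finset.card_bij (fun i _ => e i) ?_ ?_ ?_
    · intro i hi
      simp only [mem_filter, mem_univ, true_and] at hi ⊢
      simpa [he] using hi
    · intro i _ j _ h
      exact e.injective h
    · intro b hb
      simp only [mem_filter, mem_univ, true_and] at hb
      refine ⟨e.symm b, ?_, by simp⟩
      simp only [mem_filter, mem_univ, true_and]
      rw [← he]
      simpa using hb

lemma key_fix {α : Type} [Fintype α] [DecidableEq α] (v : α → ℤ)
    (hv : Function.Injective v) (x : ℝ) (c : α → ℝ) :
    ∑ w : Equiv.Perm α, ∏ i, (if v i < v (w i) then x else if w i = i then c i else 1)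
      = ∑ J : Finset α, (∏ j ∈ J, c j) * (dA (Fintype.card α - J.card)).eval x := by
  rw [← Finset.sum_fiberwise_of_maps_to (s := univ) (t := univ)
    (g := fun w : Equiv.Perm α => univ.filter (fun i => w i = i)) (fun _ _ => mem_univ _)]
  refine Finset.sum_congr rfl fun J _ => ?_
  have hcard : Fintype.card {a // a ∉ J} = Fintype.card α - J.card := by
    simp [Fintype.card_subtype_compl]
  rw [← dA_transport (β := {a // a ∉ J}) (fun a => v a.1)
    (hv.comp Subtype.val_injective) x _ hcard, Finset.mul_sum]
  symm
  refine Finset.sum_bij (fun τ _ => Equiv.Perm.ofSubtype τ) ?_ ?_ ?_ ?_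
  · intro τ hτ
    simp only [mem_filter, mem_univ, true_and] at hτ ⊢
    ext i
    simp only [mem_filter, mem_univ, true_and]
    by_cases hi : i ∈ J
    · simp only [hi, iff_true]
      exact Equiv.Perm.ofSubtype_apply_of_not_mem τ (by simpa using hi)
    · simp only [hi, iff_false]
      rw [Equiv.Perm.ofSubtype_apply_of_mem τ hi]
      intro h
      exact hτ ⟨i, hi⟩ (Subtype.ext h)
  · intro a _ b _ h
    exact Equiv.Perm.ofSubtype_injective h
  · intro w hw
    simp only [mem_filter, mem_univ, true_and] at hw
    have hJ : ∀ i, i ∈ J ↔ w i = i := by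
      intro i; rw [← hw]; simp
    have h1 : ∀ i, i ∉ J ↔ w i ∉ J := by
      intro i; rw [hJ, hJ]; simp
    refine ⟨w.subtypePerm (fun i => (h1 i).symm), ?_, ?_⟩
    · simp only [mem_filter, mem_univ, true_and]
      intro i hi
      apply i.2
      rw [hJ]
      simpa using congrArg Subtype.val hi
    · apply Equiv.Perm.ofSubtype_subtypePerm
      intro i hi
      rw [hJ]; exact hi
  · intro τ hτ
    simp only [mem_filter, mem_univ, true_and] at hτ
    rw [← Finset.prod_mul_prod_compl J]
    congr 1
    · refine Finset.prod_congr rfl fun i hi => ?_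
      have : Equiv.Perm.ofSubtype τ i = i :=
        Equiv.Perm.ofSubtype_apply_of_not_mem τ (by simpa using hi)
      simp [this]
    · have h2 : ∏ i ∈ Jᶜ, (if v i < v (Equiv.Perm.ofSubtype τ i) then x
          else if Equiv.Perm.ofSubtype τ i = i then c i else 1)
          = ∏ i : {a // a ∉ J}, (if v i.1 < v (τ i).1 then x else 1) := by
        rw [← Finset.prod_subtype_of_mem
          (f := fun i => if v i < v (Equiv.Perm.ofSubtype τ i) then x
          else if Equiv.Perm.ofSubtype τ i = i then c i else 1) (p := fun a => a ∉ J)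
          (s := Jᶜ) (by simp)]
        refine Finset.prod_congr (by ext a; simp [a.2]) fun i _ => ?_
        have h3 : Equiv.Perm.ofSubtype τ i.1 = (τ i).1 :=
          Equiv.Perm.ofSubtype_apply_of_mem τ i.2
        have h4 : (τ i).1 ≠ i.1 := fun h => hτ i (Subtype.ext h)
        rw [h3]; simp [h4]
      rw [h2, Finset.prod_ite]
      simp

lemma sum_card_fun (n : ℕ) (f : ℕ → ℝ) :
    ∑ J : Finset (Fin n), f J.card = ∑ j ∈ range (n + 1), (n.choose j : ℝ) * f j := by
  have := Finset.sum_powerset_apply_card f (x := (univ : Finset (Fin n)))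
  simpa using this

lemma perm_fix_gf (n : ℕ) (x y : ℝ) :
    ∑ w : Equiv.Perm (Fin n), ∏ i, (if i < w i then x else if w i = i then y else 1)
      = ∑ j ∈ range (n + 1), (n.choose j : ℝ) * (y ^ j * (dA (n - j)).eval x) := by
  have := key_fix (α := Fin n) (fun i => (i : ℤ)) (fun a b h => Fin.ext (by simpa using h)) x
    (fun _ => y)
  simp only [Fintype.card_fin, prod_const] at this
  rw [sum_card_fun n (fun j => y ^ j * (dA (n - j)).eval x)] at this
  rw [← this]
  simp

lemma dA_rec (n : ℕ) (x : ℝ) :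
    ∑ j ∈ range (n + 2), ((n+1).choose j : ℝ) * (x ^ j * (dA (n + 1 - j)).eval x)
      = x * ∑ j ∈ range (n + 2), ((n+1).choose j : ℝ) * (dA (n + 1 - j)).eval x := by
  have h1 := perm_fix_gf (n+1) x x
  have h2 := perm_fix_gf (n+1) x 1
  simp only [one_pow, one_mul] at h2
  rw [← h1, ← h2, Finset.mul_sum]
  refine Finset.sum_equiv (Equiv.mulLeft (finRotate (n+1))) (by simp) ?_
  intro w _
  have hmul : ∀ i, (Equiv.mulLeft (finRotate (n+1)) w) i = finRotate (n+1) (w i) := fun _ => rfl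
  simp only [hmul]
  have hx : x = ∏ i : Fin (n+1), if i = w.symm (Fin.last n) then x else 1 := by simp
  conv_rhs => rw [hx]
  rw [← Finset.prod_mul_distrib]
  refine Finset.prod_congr rfl fun i _ => ?_
  rw [← hx]
  by_cases hi : w i = Fin.last n
  · have hi' : i = w.symm (Fin.last n) := by rw [← hi]; simp
    simp only [hi, if_pos hi']
    have : i ≤ Fin.last n := Fin.le_last i
    rcases this.lt_or_eq with h | h
    · simp [h]
    · simp [h]
  · have hi' : ¬ i = w.symm (Fin.last n) := by
      intro h; apply hi; rw [h]; simp
    rw [if_neg hi', one_mul]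
    have hlt : w i < Fin.last n := lt_of_le_of_ne (Fin.le_last _) hi
    have hr : ((finRotate (n+1) (w i) : Fin (n+1)) : ℕ) = w i + 1 := by
      rw [coe_finRotate_of_ne_last hi]
    simp only [Fin.lt_def, Fin.ext_iff, hr]
    split_ifs <;> first | rfl | (exfalso; omega)

lemma dB_formula (n : ℕ) (x : ℝ) :
    (dB n).eval x = ∑ j ∈ range (n + 1),
      (n.choose j : ℝ) * (x ^ j * (2 ^ (n - j) * (dA (n - j)).eval x)) := by
  have hv : ∀ ε : Fin n → Bool, Function.Injective
      (fun k : Fin n => if ε k then ((k : ℤ) + 1) else -((k : ℤ) + 1)) := by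
    intro ε a b h
    apply Fin.ext
    simp only at h
    split_ifs at h <;> omega
  have hB : (dB n).eval x = ∑ ε : Fin n → Bool, ∑ w : Equiv.Perm (Fin n),
      ∏ i, (if (if ε i then ((i : ℤ) + 1) else -((i : ℤ) + 1)) <
        (if ε (w i) then ((w i : ℤ) + 1) else -((w i : ℤ) + 1))
        then x else if w i = i then (if ε i then 0 else x) else 1) := by
    have h1 : (dB n).eval x = ∑ u ∈ univ.filter (fun u : Fin n → Fin n × Bool => IsSP u),
        if IsDerB u then x ^ excB u else 0 := by
      unfold dB
      rw [Polynomial.eval_finsetSum, ← Finset.filter_filter, Finset.sum_filter]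
      simp
    rw [h1, ← Finset.sum_product']
    symm
    refine Finset.sum_bij (fun (p : (Fin n → Bool) × Equiv.Perm (Fin n)) _ =>
      fun i => (p.2 i, p.1 (p.2 i))) ?_ ?_ ?_ ?_
    · rintro ⟨ε, w⟩ _
      refine mem_filter.2 ⟨mem_univ _, ?_⟩
      exact w.bijective
    · rintro ⟨ε, w⟩ _ ⟨ε', w'⟩ _ h
      simp only [funext_iff, Prod.mk.injEq] at h
      have hw : w = w' := Equiv.ext fun i => (h i).1
      subst hw
      have : ε = ε' := by
        funext k
        have := (h (w.symm k)).2
        simpa using this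
      rw [this]
    · intro u hu
      replace hu := (mem_filter.1 hu).2
      unfold IsSP at hu
      let w : Equiv.Perm (Fin n) := Equiv.ofBijective _ hu
      refine ⟨(fun k => (u (w.symm k)).2, w), by simp, ?_⟩
      funext i
      simp only [Equiv.symm_apply_apply]
      rfl
    · rintro ⟨ε, w⟩ _
      set u : Fin n → Fin n × Bool := fun i => (w i, ε (w i)) with hu
      have ha : ∀ k, aVal u k = if ε k then ((k : ℤ) + 1) else -((k : ℤ) + 1) := by
        intro k
        unfold aVal
        have : (∃ j, u j = (k, true)) ↔ ε k = true := by
          constructor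
          · rintro ⟨j, hj⟩
            simp only [hu, Prod.mk.injEq] at hj
            rw [← hj.1]; exact hj.2
          · intro h
            exact ⟨w.symm k, by simp [hu, h]⟩
        simp only [this]
      have hl : ∀ i, letterW u i = if ε (w i) then ((w i : ℤ) + 1) else -((w i : ℤ) + 1) := by
        intro i; rfl
      have heq : ∀ i, letterW u i = aVal u i ↔ w i = i := by
        intro i
        rw [hl, ha]
        exact (hv ε).eq_iff
      have hp : ∀ i, (0 < aVal u i) ↔ ε i = true := by
        intro i; rw [ha]; split_ifs with h <;> simp [h] <;> omega
      have hn : ∀ i, (aVal u i < 0) ↔ ε i = false := by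
        intro i; rw [ha]; split_ifs with h <;> simp [h] <;> omega
      have hla : ∀ i, aVal u (w i) = letterW u i := fun i => by rw [ha, hl]
      simp only [← ha, hla]
      by_cases hd : IsDerB u
      · rw [if_pos hd]
        unfold excB
        rw [Finset.card_filter, ← Finset.prod_pow_eq_pow_sum]
        refine Finset.prod_congr rfl fun i _ => ?_
        have hdi := hd i
        rw [Ne, heq, hp] at hdi
        simp only [heq, hn]
        by_cases h1 : aVal u i < letterW u i
        · simp [h1]
        · by_cases h2 : w i = i
          · have : ε i = false := by
              cases h : ε i
              · rfl
              · exact absurd h2 (hdi h)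
            simp [h1, h2, this]
          · simp [h1, h2]
      · rw [if_neg hd]
        unfold IsDerB at hd
        push Not at hd
        obtain ⟨k, hk, hk2⟩ := hd
        refine Finset.prod_eq_zero (mem_univ k) ?_
        have h3 := (hp k).1 hk
        have h4 := (heq k).1 hk2
        simp [hk2, h3, h4]
  rw [hB]
  have : ∀ ε : Fin n → Bool, _ := fun ε => key_fix (α := Fin n) _ (hv ε) x
    (fun i => if ε i then 0 else x)
  simp only [this, Fintype.card_fin]
  rw [Finset.sum_comm]
  rw [← sum_card_fun n (fun j => x ^ j * (2 ^ (n - j) * (dA (n - j)).eval x))]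
  refine Finset.sum_congr rfl fun J _ => ?_
  rw [← Finset.sum_mul, ← mul_assoc]
  congr 1
  have h5 : ∀ ε : Fin n → Bool, ∏ j ∈ J, (if ε j then (0:ℝ) else x)
      = ∏ j, (if j ∈ J then (if ε j then (0:ℝ) else x) else 1) := by
    intro ε
    rw [Finset.prod_ite_mem]; simp
  simp only [h5]
  rw [← Fintype.prod_sum (fun (j : Fin n) (b : Bool) =>
    if j ∈ J then (if b then (0:ℝ) else x) else 1)]
  have h6 : ∀ j : Fin n, (∑ b : Bool, if j ∈ J then (if b then (0:ℝ) else x) else 1)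
      = if j ∈ J then x else 2 := by
    intro j
    by_cases h : j ∈ J
    · simp [h]
    · simp [h]
  simp only [h6]
  rw [Finset.prod_ite]
  simp only [prod_const]
  congr 2
  · simp
  · rw [show (univ.filter fun j => j ∉ J) = Jᶜ by ext; simp, Finset.card_compl]; simp

lemma desA_succ {n : ℕ} (w : Equiv.Perm (Fin (n + 1))) :
    desA w = ∑ i : Fin n, if w i.succ < w i.castSucc then 1 else 0 := by
  unfold desA
  rw [Finset.card_filter, Fin.sum_univ_castSucc]
  have hlast : ¬ (((Fin.last n : Fin (n+1)) : ℕ) + 1 < n + 1) := by simp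
  rw [if_neg (fun h => hlast h.1), add_zero]
  refine Finset.sum_congr rfl fun i _ => ?_
  have h1 : (⟨((i.castSucc : Fin (n+1)) + 1) % (n+1), Nat.mod_lt _ i.castSucc.pos⟩ : Fin (n+1))
      = i.succ := by
    apply Fin.ext
    simp only [Fin.val_castSucc, Fin.val_succ]
    exact Nat.mod_eq_of_lt (by have := i.isLt; omega)
  have h2 : ((i.castSucc : Fin (n+1)) : ℕ) + 1 < n + 1 := by simp
  simp only [h1, h2, true_and]

/-- prepend the letter `j` to the permutation `σ` -/
def consPerm {n : ℕ} (j : Fin (n + 1)) (σ : Equiv.Perm (Fin n)) : Equiv.Perm (Fin (n + 1)) :=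
  (finSuccEquiv' 0).trans ((Equiv.optionCongr σ).trans (finSuccEquiv' j).symm)

lemma consPerm_zero {n : ℕ} (j : Fin (n + 1)) (σ : Equiv.Perm (Fin n)) :
    consPerm j σ 0 = j := by
  simp [consPerm]

lemma consPerm_succ {n : ℕ} (j : Fin (n + 1)) (σ : Equiv.Perm (Fin n)) (i : Fin n) :
    consPerm j σ i.succ = j.succAbove (σ i) := by
  have : finSuccEquiv' (0 : Fin (n+1)) i.succ = some i := by
    rw [← Fin.succAbove_zero, finSuccEquiv'_succAbove]
  simp [consPerm, this]

lemma consPerm_bij (n : ℕ) : Function.Bijective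
    (fun p : Fin (n + 1) × Equiv.Perm (Fin n) => consPerm p.1 p.2) := by
  rw [Fintype.bijective_iff_injective_and_card]
  constructor
  · rintro ⟨j, σ⟩ ⟨j', σ'⟩ h
    simp only at h
    have h0 : j = j' := by rw [← consPerm_zero j σ, h, consPerm_zero]
    subst h0
    have : σ = σ' := by
      ext i : 1
      have := consPerm_succ j σ i
      rw [h, consPerm_succ] at this
      exact (Fin.succAbove_right_injective this).symm
    rw [this]
  · simp [Fintype.card_perm, Nat.factorial_succ]

lemma sum_consPerm {n : ℕ} (f : Equiv.Perm (Fin (n + 1)) → ℝ) :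
    ∑ w, f w = ∑ j : Fin (n + 1), ∑ σ : Equiv.Perm (Fin n), f (consPerm j σ) := by
  rw [← Finset.sum_product']
  symm
  exact Function.Bijective.sum_comp (consPerm_bij n) f

lemma desA_consPerm {n : ℕ} (j : Fin (n + 2)) (σ : Equiv.Perm (Fin (n + 1))) :
    desA (consPerm j σ) = (if (σ 0).castSucc < j then 1 else 0) + desA σ := by
  rw [desA_succ, desA_succ, Fin.sum_univ_succ]
  congr 1
  · rw [consPerm_succ, Fin.castSucc_zero, consPerm_zero]
    simp only [Fin.succAbove_lt_iff_castSucc_lt]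
  · refine Finset.sum_congr rfl fun i _ => ?_
    have h : i.succ.castSucc = (i.castSucc).succ := rfl
    rw [h, consPerm_succ, consPerm_succ]
    simp only [Fin.succAbove_lt_succAbove_iff]

/-- Eulerian polynomial values, with value `1` at `n = 0` -/
noncomputable def AE (x : ℝ) (n : ℕ) : ℝ := ∑ w : Equiv.Perm (Fin n), x ^ desA w

/-- contribution of the permutations with first letter `j` -/
noncomputable def PE (x : ℝ) (n : ℕ) (j : Fin (n + 1)) : ℝ :=
  ∑ σ : Equiv.Perm (Fin n), x ^ desA (consPerm j σ)

lemma AE_eq_sum_PE (x : ℝ) (n : ℕ) : AE x (n + 1) = ∑ j, PE x n j :=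
  sum_consPerm _

lemma PE_succ (x : ℝ) (n : ℕ) (j : Fin (n + 2)) :
    PE x (n + 1) j = AE x (n + 1) +
      (x - 1) * ∑ i : Fin (n + 1), if i.castSucc < j then PE x n i else 0 := by
  have h1 : PE x (n + 1) j = ∑ σ : Equiv.Perm (Fin (n + 1)), (x ^ desA σ +
      (x - 1) * (if (σ 0).castSucc < j then x ^ desA σ else 0)) := by
    unfold PE
    refine Finset.sum_congr rfl fun σ _ => ?_
    rw [desA_consPerm]
    split_ifs
    · rw [pow_add]; ring
    · simp
  rw [h1, Finset.sum_add_distrib, ← Finset.mul_sum]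
  congr 2
  rw [sum_consPerm]
  refine Finset.sum_congr rfl fun i _ => ?_
  simp only [consPerm_zero]
  split_ifs
  · rfl
  · simp

lemma sum_range_choose_col (j r : ℕ) : ∑ i ∈ range j, i.choose r = j.choose (r + 1) := by
  induction j with
  | zero => simp
  | succ j ih => rw [Finset.sum_range_succ, ih, Nat.choose_succ_succ, add_comm]

lemma PE_formula (x : ℝ) (n : ℕ) : ∀ j : Fin (n + 1),
    PE x n j = ∑ r ∈ range (n + 1), (x - 1) ^ r * ((j : ℕ).choose r : ℝ) * AE x (n - r) := by
  induction n with
  | zero =>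
    intro j
    have : j = 0 := Fin.ext (by omega)
    subst this
    simp [PE, AE, desA]
  | succ n ih =>
    intro j
    rw [PE_succ, Finset.sum_range_succ']
    simp only [ih]
    have h1 : (∑ i : Fin (n + 1), if i.castSucc < j then
        ∑ r ∈ range (n + 1), (x - 1) ^ r * ((i : ℕ).choose r : ℝ) * AE x (n - r) else 0)
        = ∑ r ∈ range (n + 1), (x - 1) ^ r * ((j : ℕ).choose (r + 1) : ℝ) * AE x (n - r) := by
      have h2 : ∀ i : Fin (n + 1), (i.castSucc < j) = ((i : ℕ) < (j : ℕ)) := fun i => rfl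
      simp only [Fin.lt_def, Fin.val_castSucc]
      rw [Fin.sum_univ_eq_sum_range (fun i => if i < (j : ℕ) then
        ∑ r ∈ range (n + 1), (x - 1) ^ r * (i.choose r : ℝ) * AE x (n - r) else 0) (n + 1),
        ← Finset.sum_filter]
      have h3 : (range (n + 1)).filter (fun i => i < (j : ℕ)) = range j := by
        ext i
        have := j.isLt
        simp only [mem_filter, mem_range]
        omega
      rw [h3, Finset.sum_comm]
      refine Finset.sum_congr rfl fun r _ => ?_
      rw [← sum_range_choose_col, ← Finset.sum_mul, ← Finset.mul_sum]
      push_cast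
      rfl
    rw [h1, Finset.mul_sum, add_comm]
    congr 1
    · refine Finset.sum_congr rfl fun r _ => ?_
      rw [Nat.add_sub_add_right]
      ring
    · simp

lemma AE_rec (x : ℝ) (n : ℕ) : AE x (n + 1) =
    ∑ r ∈ range (n + 1), (x - 1) ^ r * ((n + 1).choose (r + 1) : ℝ) * AE x (n - r) := by
  rw [AE_eq_sum_PE]
  simp only [PE_formula]
  rw [Finset.sum_comm]
  refine Finset.sum_congr rfl fun r _ => ?_
  rw [← sum_range_choose_col, ← Finset.sum_mul, ← Finset.mul_sum]
  rw [Fin.sum_univ_eq_sum_range (fun i => (i.choose r : ℝ)) (n + 1)]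
  push_cast
  rfl

lemma AE_zero (x : ℝ) : AE x 0 = 1 := by simp [AE, desA]

lemma Apoly_eval (x : ℝ) (n : ℕ) : (Apoly n).eval x = if n = 0 then 0 else AE x n := by
  unfold Apoly AE
  split_ifs
  · simp
  · simp [Polynomial.eval_finsetSum]

lemma dA_zero (x : ℝ) : (dA 0).eval x = 1 := by simp [dA, excA]

/-- exponential generating function -/
noncomputable def egf (f : ℕ → ℝ) : PowerSeries ℝ := PowerSeries.mk fun n => f n / (n.factorial : ℝ)

lemma coeff_egf (f : ℕ → ℝ) (n : ℕ) : PowerSeries.coeff n (egf f) = f n / (n.factorial : ℝ) := by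
  simp [egf]

lemma egf_mul (f g : ℕ → ℝ) : egf f * egf g =
    egf (fun n => ∑ j ∈ range (n + 1), (n.choose j : ℝ) * (f j * g (n - j))) := by
  ext n
  rw [PowerSeries.coeff_mul, coeff_egf, Finset.Nat.sum_antidiagonal_eq_sum_range_succ_mk,
    Finset.sum_div]
  refine Finset.sum_congr rfl fun j hj => ?_
  have hj' : j ≤ n := by simpa [Nat.lt_succ_iff] using hj
  rw [coeff_egf, coeff_egf, Nat.cast_choose ℝ hj']
  have h1 : (j.factorial : ℝ) ≠ 0 := by exact_mod_cast j.factorial_ne_zero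
  have h2 : ((n - j).factorial : ℝ) ≠ 0 := by exact_mod_cast (n - j).factorial_ne_zero
  have h3 : (n.factorial : ℝ) ≠ 0 := by exact_mod_cast n.factorial_ne_zero
  field_simp

lemma egf_pow (a : ℝ) : egf (fun n => a ^ n) = PowerSeries.rescale a (PowerSeries.exp ℝ) := by
  ext n
  rw [coeff_egf, PowerSeries.coeff_rescale, PowerSeries.coeff_exp]
  simp [div_eq_mul_inv]

lemma egf_pow_mul (a b : ℝ) : egf (fun n => a ^ n) * egf (fun n => b ^ n)
    = egf (fun n => (a + b) ^ n) := by
  rw [egf_pow, egf_pow, egf_pow, PowerSeries.exp_mul_exp_eq_exp_add]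

lemma egf_rescale (a : ℝ) (f : ℕ → ℝ) :
    PowerSeries.rescale a (egf f) = egf (fun n => a ^ n * f n) := by
  ext n
  rw [PowerSeries.coeff_rescale, coeff_egf, coeff_egf]; ring

lemma egf_ext_mul (n : ℕ) (f : ℕ → ℝ) : PowerSeries.coeff n (egf f) * (n.factorial : ℝ) = f n := by
  have h3 : (n.factorial : ℝ) ≠ 0 := by exact_mod_cast n.factorial_ne_zero
  rw [coeff_egf]; field_simp

lemma D_eq (x : ℝ) : egf (fun n => (dA n).eval x) *
    (egf (fun n => x ^ n) - PowerSeries.C x * egf (fun n => 1 ^ n)) = PowerSeries.C (1 - x) := by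
  have h : egf (fun n => x ^ n) * egf (fun n => (dA n).eval x) -
    PowerSeries.C x * (egf (fun n => 1 ^ n) * egf (fun n => (dA n).eval x))
      = PowerSeries.C (1 - x) := by
    rw [egf_mul, egf_mul]
    ext n
    rw [map_sub, PowerSeries.coeff_C_mul, coeff_egf, coeff_egf]
    cases n with
    | zero => simp [dA_zero]
    | succ n =>
      rw [PowerSeries.coeff_C, if_neg (by omega)]
      have := dA_rec n x
      simp only [one_pow, one_mul]
      rw [this]; ring
  rw [← h]; ring

lemma a_eq1 (x : ℝ) : egf (AE x) = 1 + egf (fun n => (Apoly n).eval x) := by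
  ext n
  rw [map_add, coeff_egf, coeff_egf, PowerSeries.coeff_one, Apoly_eval]
  cases n with
  | zero => simp [AE_zero]
  | succ n => simp

lemma a_eq2 (x : ℝ) : egf (fun n => (x - 1) ^ n) * egf (AE x)
    = egf (AE x) + PowerSeries.C (x - 1) * (egf (AE x) - 1) := by
  rw [egf_mul]
  ext n
  rw [map_add, PowerSeries.coeff_C_mul, map_sub, coeff_egf, coeff_egf, PowerSeries.coeff_one]
  cases n with
  | zero => simp [AE_zero]
  | succ n =>
    rw [Finset.sum_range_succ', if_neg (by omega)]
    have h : ∑ k ∈ range (n + 1), ((n + 1).choose (k + 1) : ℝ) *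
        ((x - 1) ^ (k + 1) * AE x (n + 1 - (k + 1))) = (x - 1) * AE x (n + 1) := by
      conv_rhs => rw [AE_rec, Finset.mul_sum]
      refine Finset.sum_congr rfl fun r _ => ?_
      rw [Nat.add_sub_add_right]; ring
    rw [h]
    simp; ring

lemma a_eq (x : ℝ) : egf (fun n => (Apoly n).eval x) *
    (egf (fun n => x ^ n) - PowerSeries.C x * egf (fun n => 1 ^ n))
      = egf (fun n => 1 ^ n) - egf (fun n => x ^ n) := by
  have h1 := a_eq2 x
  rw [a_eq1] at h1
  have h2 := egf_pow_mul (x - 1) 1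
  rw [sub_add_cancel] at h2
  rw [← h2]
  rw [map_sub, map_one] at h1
  linear_combination (egf (fun n => 1 ^ n)) * h1

lemma B_eq (x : ℝ) : egf (fun n => (dB n).eval x) =
    egf (fun n => x ^ n) * PowerSeries.rescale 2 (egf (fun n => (dA n).eval x)) := by
  rw [egf_rescale, egf_mul]
  congr 1
  funext n
  rw [dB_formula]

lemma D2_eq (x : ℝ) : PowerSeries.rescale 2 (egf (fun n => (dA n).eval x)) *
    (egf (fun n => x ^ n) ^ 2 - PowerSeries.C x * egf (fun n => 1 ^ n) ^ 2)
      = PowerSeries.C (1 - x) := by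
  have h := congrArg (PowerSeries.rescale (2 : ℝ)) (D_eq x)
  have hC : ∀ y : ℝ, PowerSeries.rescale (2 : ℝ) (PowerSeries.C y) = PowerSeries.C y := by
    intro y
    ext n
    rw [PowerSeries.coeff_rescale, PowerSeries.coeff_C]
    split_ifs with h <;> simp [h]
  have hp : ∀ y : ℝ, PowerSeries.rescale (2 : ℝ) (egf fun n => y ^ n)
      = egf (fun n => y ^ n) ^ 2 := by
    intro y
    rw [sq, egf_pow_mul, egf_rescale]
    congr 1
    funext n
    rw [← mul_pow]; ring
  rw [map_mul, map_sub, map_mul, hC, hC, hp, hp] at h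
  exact h

lemma main_gf (x : ℝ) (hx : x ≠ 1) : egf (fun n => (dB n).eval x) *
    (1 - PowerSeries.C x * egf (fun n => (Apoly n).eval x) ^ 2) =
    egf (fun n => (dA n).eval x) * (1 + PowerSeries.C x * egf (fun n => (Apoly n).eval x)) := by
  have hD := D_eq x
  have ha := a_eq x
  have hD2 := D2_eq x
  rw [B_eq]
  have hs : egf (fun n => x ^ n) - PowerSeries.C x * egf (fun n => 1 ^ n) ≠ 0 := by
    intro h
    have := congrArg (PowerSeries.coeff 0) h
    rw [map_sub, PowerSeries.coeff_C_mul, coeff_egf, coeff_egf] at this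
    simp at this
    apply hx; linarith
  have hs2 := pow_ne_zero 2 hs
  apply mul_right_cancel₀ hs2
  rw [map_sub, map_one] at hD hD2
  generalize egf (fun n => x ^ n) = p at *
  generalize egf (fun n => (1:ℝ) ^ n) = q at *
  generalize egf (fun n => (dA n).eval x) = D at *
  generalize egf (fun n => (Apoly n).eval x) = a at *
  generalize PowerSeries.rescale (2:ℝ) D = D2 at *
  generalize PowerSeries.C x = y at *
  have e1 : (p * D2 * (1 - y * a ^ 2)) * (p - y * q) ^ 2
      = p * D2 * ((p - y * q) ^ 2 - y * (a * (p - y * q)) ^ 2) := by ring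
  have e2 : (D * (1 + y * a)) * (p - y * q) ^ 2
      = (D * (p - y * q)) * ((p - y * q) + y * (a * (p - y * q))) := by ring
  rw [e1, e2, ha, hD]
  linear_combination p * (1 - y) * hD2

lemma coeff_prod_egf (m n : ℕ) (f : Fin m → ℕ → ℝ) :
    PowerSeries.coeff n (∏ i, egf (f i)) * (n.factorial : ℝ) =
      ∑ r ∈ Finset.Nat.antidiagonalTuple m n,
        (Nat.multinomial univ r : ℝ) * ∏ i, f i (r i) := by
  rw [PowerSeries.coeff_prod, Finset.sum_mul]
  refine Finset.sum_bij (fun l _ => (l : Fin m → ℕ)) ?_ ?_ ?_ ?_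
  · intro l hl
    rw [Finset.mem_finsuppAntidiag] at hl
    rw [Finset.Nat.mem_antidiagonalTuple]
    exact hl.1
  · intro a _ b _ h
    exact DFunLike.coe_injective h
  · intro r hr
    rw [Finset.Nat.mem_antidiagonalTuple] at hr
    refine ⟨Finsupp.equivFunOnFinite.symm r, ?_, by simp⟩
    rw [Finset.mem_finsuppAntidiag]
    exact ⟨by simpa using hr, by simp⟩
  · intro l hl
    rw [Finset.mem_finsuppAntidiag] at hl
    have hs := Nat.multinomial_spec univ (l : Fin m → ℕ)
    rw [show (∑ i, l i) = n from hl.1] at hs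
    rw [← hs]
    push_cast
    simp only [coeff_egf]
    rw [Finset.prod_div_distrib]
    have h0 : (∏ i, ((l i).factorial : ℝ)) ≠ 0 :=
      Finset.prod_ne_zero_iff.2 fun i _ => by exact_mod_cast (l i).factorial_ne_zero
    field_simp

lemma coeff_dam (m n : ℕ) (d a : ℕ → ℝ) :
    PowerSeries.coeff n (egf d * egf a ^ m) * (n.factorial : ℝ) =
      ∑ r ∈ Finset.Nat.antidiagonalTuple (m + 1) n,
        (Nat.multinomial univ r : ℝ) * (d (r 0) * ∏ i : Fin m, a (r i.succ)) := by
  have := coeff_prod_egf (m + 1) n (Fin.cons d (fun _ => a))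
  simp only [Fin.prod_univ_succ, Fin.cons_zero, Fin.cons_succ, prod_const, card_univ,
    Fintype.card_fin] at this
  exact this

/-- polynomial form of `f_n^+` -/
noncomputable def qp (n : ℕ) : Polynomial ℝ := ∑ k ∈ Finset.range (n + 1),
  ∑ r ∈ Finset.Nat.antidiagonalTuple (2 * k + 1) n,
    (Nat.multinomial Finset.univ r : Polynomial ℝ) * X ^ k *
      dA (r 0) * ∏ i : Fin (2 * k), Apoly (r i.succ)

/-- polynomial form of `f_n^-` -/
noncomputable def qm (n : ℕ) : Polynomial ℝ := ∑ k ∈ Finset.range (n + 1),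
  ∑ r ∈ Finset.Nat.antidiagonalTuple (2 * k + 2) n,
    (Nat.multinomial Finset.univ r : Polynomial ℝ) * X ^ (k + 1) *
      dA (r 0) * ∏ i : Fin (2 * k + 1), Apoly (r i.succ)

lemma qp_eval (n : ℕ) (x : ℝ) : (qp n).eval x = ∑ k ∈ range (n + 1), x ^ k *
    (PowerSeries.coeff n (egf (fun n => (dA n).eval x) * egf (fun n => (Apoly n).eval x) ^ (2 * k))
      * (n.factorial : ℝ)) := by
  unfold qp
  simp only [eval_finsetSum, coeff_dam, Finset.mul_sum, eval_mul, eval_natCast, eval_pow, eval_X,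
    eval_prod]
  refine Finset.sum_congr rfl fun k _ => Finset.sum_congr rfl fun r _ => ?_
  ring

lemma qm_eval (n : ℕ) (x : ℝ) : (qm n).eval x = ∑ k ∈ range (n + 1), x ^ (k + 1) *
    (PowerSeries.coeff n
      (egf (fun n => (dA n).eval x) * egf (fun n => (Apoly n).eval x) ^ (2 * k + 1))
      * (n.factorial : ℝ)) := by
  unfold qm
  simp only [eval_finsetSum, coeff_dam, Finset.mul_sum, eval_mul, eval_natCast, eval_pow, eval_X,
    eval_prod]
  refine Finset.sum_congr rfl fun k _ => Finset.sum_congr rfl fun r _ => ?_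
  ring

lemma dB_eval_eq (n : ℕ) (x : ℝ) (hx : x ≠ 1) :
    (dB n).eval x = (qp n).eval x + (qm n).eval x := by
  have h := main_gf x hx
  rw [qp_eval, qm_eval, ← egf_ext_mul n (fun n => (dB n).eval x), ← Finset.sum_add_distrib]
  set B := egf (fun n => (dB n).eval x)
  set D := egf (fun n => (dA n).eval x)
  set a := egf (fun n => (Apoly n).eval x) with ha
  set y := PowerSeries.C x with hy
  have hgeom := mul_neg_geom_sum (y * a ^ 2) (n + 1)
  have hB : B = B * (y * a ^ 2) ^ (n + 1) +
      ∑ k ∈ range (n + 1), (y ^ k * (D * a ^ (2 * k)) + y ^ (k + 1) * (D * a ^ (2 * k + 1))) := by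
    have e : ∑ k ∈ range (n + 1),
        (y ^ k * (D * a ^ (2 * k)) + y ^ (k + 1) * (D * a ^ (2 * k + 1)))
        = (D * (1 + y * a)) * ∑ k ∈ range (n + 1), (y * a ^ 2) ^ k := by
      rw [Finset.mul_sum]
      refine Finset.sum_congr rfl fun k _ => ?_
      rw [mul_pow, ← pow_mul]; ring
    rw [e, ← h, mul_assoc, hgeom]; ring
  have hXa : PowerSeries.X ∣ a := by
    rw [PowerSeries.X_dvd_iff, ← PowerSeries.coeff_zero_eq_constantCoeff_apply, ha, coeff_egf,
      Apoly_eval]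
    simp
  have h0 : PowerSeries.coeff n (B * (y * a ^ 2) ^ (n + 1)) = 0 := by
    have hd : (PowerSeries.X : PowerSeries ℝ) ^ (n + 1) ∣ B * (y * a ^ 2) ^ (n + 1) :=
      Dvd.dvd.mul_left (pow_dvd_pow_of_dvd
        (Dvd.dvd.mul_left (hXa.trans (dvd_pow_self a two_ne_zero)) y) _) B
    exact PowerSeries.X_pow_dvd_iff.1 hd n (Nat.lt_succ_self n)
  have hc := congrArg (PowerSeries.coeff n) hB
  rw [map_add, h0, zero_add, map_sum] at hc
  rw [hc, Finset.sum_mul]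
  refine Finset.sum_congr rfl fun k _ => ?_
  rw [map_add, hy, ← map_pow, ← map_pow, PowerSeries.coeff_C_mul, PowerSeries.coeff_C_mul]
  ring

lemma dB_eq_qp_qm (n : ℕ) : dB n = qp n + qm n := by
  apply Polynomial.eq_of_infinite_eval_eq
  refine Set.Infinite.mono (s := Set.Ioi 1) ?_ (Set.Ioi_infinite 1)
  intro x hx
  simp only [Set.mem_ofPred_eq, eval_add]
  exact dB_eval_eq n x (ne_of_gt hx)

/-! ### Rational function part -/

lemma one_add_ne : (1 + RatFunc.X : RatFunc ℝ) ≠ 0 := by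
  intro h
  have h2 : algebraMap (Polynomial ℝ) (RatFunc ℝ) (1 + X) = 0 := by
    rw [map_add, map_one, RatFunc.algebraMap_X, h]
  rw [map_eq_zero_iff _ (RatFunc.algebraMap_injective ℝ)] at h2
  have := congrArg (Polynomial.eval 0) h2
  simp at this

lemma clear_den (P : Polynomial ℝ) : ∃ (N : ℕ) (R : Polynomial ℝ),
    algebraMap (Polynomial ℝ) (RatFunc ℝ) R = (1 + RatFunc.X) ^ N * Polynomial.aeval yRat P ∧
    ∀ x : ℝ, x ≠ -1 → R.eval x = (1 + x) ^ N * P.eval (x / (1 + x) ^ 2) := by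
  induction P using Polynomial.induction_on' with
  | add p q hp hq =>
    obtain ⟨N, R, h1, h2⟩ := hp
    obtain ⟨M, S, h3, h4⟩ := hq
    refine ⟨N + M, (1 + X) ^ M * R + (1 + X) ^ N * S, ?_, ?_⟩
    · simp only [map_add, map_mul, map_pow, map_one, RatFunc.algebraMap_X, h1, h3]; ring
    · intro x hx
      simp only [eval_add, eval_mul, eval_pow, eval_one, eval_X, h2 x hx, h4 x hx]; ring
  | monomial k c =>
    refine ⟨2 * k, C c * X ^ k, ?_, ?_⟩
    · rw [Polynomial.aeval_monomial, map_mul, map_pow, RatFunc.algebraMap_X, yRat, div_pow,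
        ← pow_mul]
      have := pow_ne_zero (2 * k) one_add_ne
      field_simp
      rw [mul_comm, RatFunc.algebraMap_C, RatFunc.algebraMap_eq_C]
    · intro x hx
      have hx' : 1 + x ≠ 0 := fun h => hx (by linarith)
      rw [eval_monomial, div_pow, ← pow_mul]
      have := pow_ne_zero (2 * k) hx'
      simp only [eval_mul, eval_C, eval_pow, eval_X]
      field_simp

lemma eval_of_ratFunc (q P : Polynomial ℝ) (n : ℕ)
    (h : algebraMap (Polynomial ℝ) (RatFunc ℝ) q
      = (1 + RatFunc.X) ^ n * Polynomial.aeval yRat P) (x : ℝ) (hx : x ≠ -1) :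
    q.eval x = (1 + x) ^ n * P.eval (x / (1 + x) ^ 2) := by
  obtain ⟨N, R, h1, h2⟩ := clear_den P
  have h3 : (1 + X) ^ N * q = (1 + X) ^ n * R := by
    apply RatFunc.algebraMap_injective ℝ
    simp only [map_add, map_mul, map_pow, map_one, RatFunc.algebraMap_X, h1, h]; ring
  have h4 := congrArg (Polynomial.eval x) h3
  simp only [eval_add, eval_mul, eval_pow, eval_one, eval_X, h2 x hx] at h4
  have hx' : 1 + x ≠ 0 := fun h => hx (by linarith)
  apply mul_left_cancel₀ (pow_ne_zero N hx')
  rw [h4]; ring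

lemma recip_of_ratFunc (q P : Polynomial ℝ) (n : ℕ)
    (h : algebraMap (Polynomial ℝ) (RatFunc ℝ) q
      = (1 + RatFunc.X) ^ n * Polynomial.aeval yRat P) (x : ℝ) (hx : 0 < x) :
    q.eval x = x ^ n * q.eval x⁻¹ := by
  have hi := inv_pos.2 hx
  rw [eval_of_ratFunc q P n h x (by linarith), eval_of_ratFunc q P n h x⁻¹ (by linarith)]
  have e1 : x⁻¹ / (1 + x⁻¹) ^ 2 = x / (1 + x) ^ 2 := by
    field_simp; ring
  rw [e1, ← mul_assoc, ← mul_pow]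
  congr 2
  field_simp; ring

lemma recip_of_symm (f : Polynomial ℝ) (n : ℕ) (hd : f.degree ≤ (n : WithBot ℕ))
    (hs : ∀ k ≤ n, f.coeff k = f.coeff (n - k)) (x : ℝ) (hx : 0 < x) :
    f.eval x = x ^ n * f.eval x⁻¹ := by
  have hlt : f.natDegree < n + 1 := Nat.lt_succ_of_le (natDegree_le_iff_degree_le.2 hd)
  rw [eval_eq_sum_range' hlt, eval_eq_sum_range' hlt, ← Finset.sum_range_reflect, Finset.mul_sum]
  refine Finset.sum_congr rfl fun k hk => ?_
  have hk' : k ≤ n := by simpa [Nat.lt_succ_iff] using hk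
  have e : n + 1 - 1 - k = n - k := by omega
  rw [e, ← hs k hk']
  obtain ⟨m, rfl⟩ := Nat.exists_eq_add_of_le hk'
  rw [Nat.add_sub_cancel_left, pow_add, inv_pow]
  have hxk := pow_ne_zero k hx.ne'
  field_simp

lemma unique_decomp (n : ℕ) (p m p' m' : Polynomial ℝ) (h : p + m = p' + m')
    (hp : ∀ x : ℝ, 0 < x → p.eval x = x ^ n * p.eval x⁻¹)
    (hp' : ∀ x : ℝ, 0 < x → p'.eval x = x ^ n * p'.eval x⁻¹)
    (hm : ∀ x : ℝ, 0 < x → m.eval x = x ^ (n + 1) * m.eval x⁻¹)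
    (hm' : ∀ x : ℝ, 0 < x → m'.eval x = x ^ (n + 1) * m'.eval x⁻¹) : p = p' ∧ m = m' := by
  have hpp : p = p' := by
    apply Polynomial.eq_of_infinite_eval_eq
    refine Set.Infinite.mono (s := Set.Ioi 1) ?_ (Set.Ioi_infinite 1)
    intro x hx
    have hx1 : 1 < x := hx
    have hx0 : 0 < x := by linarith
    have e1 := congrArg (Polynomial.eval x) h
    have e2 := congrArg (Polynomial.eval x⁻¹) h
    rw [eval_add, eval_add] at e1 e2
    have a1 := hp x hx0
    have a2 := hp' x hx0
    have a3 := hm x hx0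
    have a4 := hm' x hx0
    have : (x - 1) * (p.eval x - p'.eval x) = 0 := by
      rw [pow_succ] at a3 a4
      linear_combination x * a1 - x * a2 - e1 + a3 - a4 + x ^ n * x * e2
    rcases mul_eq_zero.1 this with h1 | h1
    · exfalso; linarith
    · simp only [Set.mem_ofPred_eq]; linarith
  refine ⟨hpp, ?_⟩
  subst hpp
  exact add_left_cancel h

lemma prod_expand (g xi : ℕ → Polynomial ℝ) (hg0 : g 0 = 0)
    (hg : ∀ m, 1 ≤ m → algebraMap (Polynomial ℝ) (RatFunc ℝ) (Apoly m)
        = (1 + RatFunc.X) ^ (m - 1) * Polynomial.aeval yRat (g m))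
    (hxi : ∀ m, algebraMap (Polynomial ℝ) (RatFunc ℝ) (dA m)
        = (1 + RatFunc.X) ^ m * Polynomial.aeval yRat (xi m))
    (m n : ℕ) (r : Fin (m + 1) → ℕ) (hr : ∑ i, r i = n) :
    (1 + RatFunc.X) ^ m * algebraMap (Polynomial ℝ) (RatFunc ℝ)
      (dA (r 0) * ∏ i : Fin m, Apoly (r i.succ)) =
    (1 + RatFunc.X) ^ n * Polynomial.aeval yRat (xi (r 0) * ∏ i : Fin m, g (r i.succ)) := by
  have h1 : ∀ k, (1 + RatFunc.X) * algebraMap (Polynomial ℝ) (RatFunc ℝ) (Apoly k)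
      = (1 + RatFunc.X) ^ k * Polynomial.aeval yRat (g k) := by
    intro k
    cases k with
    | zero => simp [hg0, Apoly]
    | succ k => rw [hg _ (by omega), Nat.add_sub_cancel, pow_succ]; ring
  have h2 : (1 + RatFunc.X) ^ m * ∏ i : Fin m, algebraMap (Polynomial ℝ) (RatFunc ℝ)
      (Apoly (r i.succ)) = ∏ i : Fin m, ((1 + RatFunc.X) ^ (r i.succ) *
        Polynomial.aeval yRat (g (r i.succ))) := by
    simp only [← h1]
    rw [Finset.prod_mul_distrib]; simp
  rw [Finset.prod_mul_distrib, Finset.prod_pow_eq_pow_sum] at h2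
  rw [Fin.sum_univ_succ] at hr
  rw [← hr, map_mul, map_prod, map_mul, map_prod, hxi, pow_add]
  linear_combination ((1 + RatFunc.X) ^ r 0 * Polynomial.aeval yRat (xi (r 0))) * h2

/-- Writing `A_m(x) = (1+x)^{m-1} γ_m(x/(1+x)²)` for `m ≥ 1` and
`d_m(x) = (1+x)^m ξ_m(x/(1+x)²)`, with `γ_m, ξ_m` having nonnegative coefficients and
the conventions `γ_0 = 0`, `ξ_0 = 1`, one has
`f_n^+(x) = (1+x)^n ξ_n^+(x/(1+x)²)` and `f_n^-(x) = (1+x)^{n+1} ξ_n^-(x/(1+x)²)`, where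
`ξ_n^+ = Σ (n choose r_0,…,r_{2k}) x^k ξ_{r_0} γ_{r_1} ⋯ γ_{r_{2k}}` and
`ξ_n^- = Σ (n choose r_0,…,r_{2k+1}) x^{k+1} ξ_{r_0} γ_{r_1} ⋯ γ_{r_{2k+1}}`,
summed over all sequences of nonnegative integers summing to `n`
(all terms with `k > n` vanish since `γ_0 = 0`). -/
theorem fplus_fminus_gamma_expansion (n : ℕ) (g xi : ℕ → Polynomial ℝ)
    (hg0 : g 0 = 0) (hxi0 : xi 0 = 1)
    (hgnn : ∀ m i, 0 ≤ (g m).coeff i) (hxinn : ∀ m i, 0 ≤ (xi m).coeff i)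
    (hg : ∀ m, 1 ≤ m → algebraMap (Polynomial ℝ) (RatFunc ℝ) (Apoly m)
        = (1 + RatFunc.X) ^ (m - 1) * Polynomial.aeval yRat (g m))
    (hxi : ∀ m, algebraMap (Polynomial ℝ) (RatFunc ℝ) (dA m)
        = (1 + RatFunc.X) ^ m * Polynomial.aeval yRat (xi m))
    (fp fm : Polynomial ℝ)
    (hsum : dB n = fp + fm)
    (hpdeg : fp.degree ≤ (n : WithBot ℕ))
    (hpsymm : ∀ k ≤ n, fp.coeff k = fp.coeff (n - k))
    (hmdeg : fm.degree ≤ ((n + 1 : ℕ) : WithBot ℕ))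
    (hmsymm : ∀ k ≤ n + 1, fm.coeff k = fm.coeff (n + 1 - k))
    :
    algebraMap (Polynomial ℝ) (RatFunc ℝ) fp
        = (1 + RatFunc.X) ^ n * Polynomial.aeval yRat
            (∑ k ∈ Finset.range (n + 1),
              ∑ r ∈ Finset.Nat.antidiagonalTuple (2 * k + 1) n,
                (Nat.multinomial Finset.univ r : Polynomial ℝ) * X ^ k *
                  xi (r 0) * ∏ i : Fin (2 * k), g (r i.succ)) ∧
    algebraMap (Polynomial ℝ) (RatFunc ℝ) fm
        = (1 + RatFunc.X) ^ (n + 1) * Polynomial.aeval yRat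
            (∑ k ∈ Finset.range (n + 1),
              ∑ r ∈ Finset.Nat.antidiagonalTuple (2 * k + 2) n,
                (Nat.multinomial Finset.univ r : Polynomial ℝ) * X ^ (k + 1) *
                  xi (r 0) * ∏ i : Fin (2 * k + 1), g (r i.succ)) := by
  have hqp : algebraMap (Polynomial ℝ) (RatFunc ℝ) (qp n)
        = (1 + RatFunc.X) ^ n * Polynomial.aeval yRat
            (∑ k ∈ Finset.range (n + 1),
              ∑ r ∈ Finset.Nat.antidiagonalTuple (2 * k + 1) n,
                (Nat.multinomial Finset.univ r : Polynomial ℝ) * X ^ k *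
                  xi (r 0) * ∏ i : Fin (2 * k), g (r i.succ)) := by
    unfold qp
    simp only [map_sum, Finset.mul_sum]
    refine Finset.sum_congr rfl fun k _ => Finset.sum_congr rfl fun r hr => ?_
    rw [Finset.Nat.mem_antidiagonalTuple] at hr
    have h := prod_expand g xi hg0 hg hxi (2 * k) n r hr
    rw [mul_assoc, mul_assoc _ (xi (r 0)), map_mul, map_mul (aeval yRat)]
    simp only [map_mul (algebraMap _ _) (Nat.cast _), map_mul (aeval yRat) (Nat.cast _),
      map_natCast, map_pow, RatFunc.algebraMap_X, aeval_X]
    have h0 := pow_ne_zero (2 * k) one_add_ne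
    have hy : yRat ^ k * (1 + RatFunc.X) ^ (2 * k) = RatFunc.X ^ k := by
      rw [yRat, div_pow, ← pow_mul]; field_simp
    rw [← hy]
    linear_combination ((Nat.multinomial Finset.univ r : RatFunc ℝ) * yRat ^ k) * h
  have hqm : algebraMap (Polynomial ℝ) (RatFunc ℝ) (qm n)
        = (1 + RatFunc.X) ^ (n + 1) * Polynomial.aeval yRat
            (∑ k ∈ Finset.range (n + 1),
              ∑ r ∈ Finset.Nat.antidiagonalTuple (2 * k + 2) n,
                (Nat.multinomial Finset.univ r : Polynomial ℝ) * X ^ (k + 1) *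
                  xi (r 0) * ∏ i : Fin (2 * k + 1), g (r i.succ)) := by
    unfold qm
    simp only [map_sum, Finset.mul_sum]
    refine Finset.sum_congr rfl fun k _ => Finset.sum_congr rfl fun r hr => ?_
    rw [Finset.Nat.mem_antidiagonalTuple] at hr
    have h := prod_expand g xi hg0 hg hxi (2 * k + 1) n r hr
    rw [mul_assoc, mul_assoc _ (xi (r 0)), map_mul, map_mul (aeval yRat)]
    simp only [map_mul (algebraMap _ _) (Nat.cast _), map_mul (aeval yRat) (Nat.cast _),
      map_natCast, map_pow, RatFunc.algebraMap_X, aeval_X]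
    have h0 := pow_ne_zero (2 * (k + 1)) one_add_ne
    have hy : yRat ^ (k + 1) * (1 + RatFunc.X) ^ (2 * (k + 1)) = RatFunc.X ^ (k + 1) := by
      rw [yRat, div_pow, ← pow_mul]; field_simp
    rw [← hy]
    linear_combination ((Nat.multinomial Finset.univ r : RatFunc ℝ) * yRat ^ (k + 1) *
      (1 + RatFunc.X)) * h
  obtain ⟨h1, h2⟩ := unique_decomp n fp fm (qp n) (qm n) (by rw [← hsum, dB_eq_qp_qm])
    (recip_of_symm fp n hpdeg hpsymm) (recip_of_ratFunc _ _ n hqp)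
    (recip_of_symm fm (n + 1) hmdeg hmsymm) (recip_of_ratFunc _ _ (n + 1) hqm)
  rw [h1, h2]
  exact ⟨hqp, hqm⟩
end

section
/- For every n ≥ 1, f_n^+(x) = Σ_{w ∈ D_n^B ∩ B_n^*} x^{exc_B(w)} and f_n^-(x) = Σ_{w ∈ D_n^B ∖ B_n^*} x^{exc_B(w)}, where B_n^* = {w ∈ B_n : w(m_w) > 0} and m_w denotes the minimum element (with respect to the usual integer order) of the domain S of w. -/
open Polynomial Finset

/-- `w ∈ B_n^*`: the image of the minimum element `m_w` of the domain `S` is positive.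
(`m_w` is `aVal u k` for the index `k` minimizing `aVal`, and `w(m_w)` is the letter
at the corresponding position of the word.) -/
def inBstar {n : ℕ} (u : Fin n → Fin n × Bool) : Prop :=
  ∃ k : Fin n, (∀ j : Fin n, aVal u k ≤ aVal u j) ∧ 0 < letterW u k

instance {n : ℕ} (u : Fin n → Fin n × Bool) : Decidable (inBstar u) := by
  unfold inBstar; infer_instance

namespace FPM

/-- reversal of the two blocks `[0,k)` and `[k,n)` -/
def rho (n k : ℕ) (i : ℕ) : ℕ := if i < k then k - 1 - i else n - 1 + k - i

/-- fixes the minimum of the first block if nonempty, reverses the rest of the blocks -/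
def tau (n k : ℕ) (i : ℕ) : ℕ := if i < k then (if i = 0 then 0 else k - i) else n - 1 + k - i

def rhoP (n k : ℕ) (hk : k ≤ n) : Equiv.Perm (Fin n) where
  toFun i := ⟨rho n k i, by have := i.2; unfold rho; split_ifs <;> omega⟩
  invFun i := ⟨rho n k i, by have := i.2; unfold rho; split_ifs <;> omega⟩
  left_inv i := by
    ext; have := i.2; simp only [rho]; split_ifs <;> omega
  right_inv i := by
    ext; have := i.2; simp only [rho]; split_ifs <;> omega

def tauP (n k : ℕ) (hk : k ≤ n) : Equiv.Perm (Fin n) where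
  toFun i := ⟨tau n k i, by have := i.2; unfold tau; split_ifs <;> omega⟩
  invFun i := ⟨tau n k i, by have := i.2; unfold tau; split_ifs <;> omega⟩
  left_inv i := by
    ext; have := i.2; simp only [tau]; split_ifs <;> omega
  right_inv i := by
    ext; have := i.2; simp only [tau]; split_ifs <;> omega

lemma tauP_tauP (n k : ℕ) (hk : k ≤ n) (i) : tauP n k hk (tauP n k hk i) = i :=
  (tauP n k hk).left_inv i

lemma rhoP_rhoP (n k : ℕ) (hk : k ≤ n) (i) : rhoP n k hk (rhoP n k hk i) = i :=
  (rhoP n k hk).left_inv i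

def excK {n : ℕ} (k : ℕ) (w : Equiv.Perm (Fin n)) : ℕ :=
  (univ.filter fun i : Fin n => i < w i ∨ ((i : ℕ) < k ∧ w i = i)).card

def derK {n : ℕ} (k : ℕ) (w : Equiv.Perm (Fin n)) : Prop :=
  ∀ i : Fin n, k ≤ (i : ℕ) → w i ≠ i

def starK {n : ℕ} (hn : 1 ≤ n) (k : ℕ) (w : Equiv.Perm (Fin n)) : Prop :=
  k ≤ (w ⟨0, hn⟩ : ℕ)

def phi {n : ℕ} (k : ℕ) (hk : k ≤ n) (w : Equiv.Perm (Fin n)) : Equiv.Perm (Fin n) :=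
  ((tauP n k hk).trans w).trans (rhoP n k hk)

lemma phi_apply {n : ℕ} (k : ℕ) (hk : k ≤ n) (w : Equiv.Perm (Fin n)) (i) :
    phi k hk w i = rhoP n k hk (w (tauP n k hk i)) := rfl

lemma phi_phi {n : ℕ} (k : ℕ) (hk : k ≤ n) (w : Equiv.Perm (Fin n)) :
    phi k hk (phi k hk w) = w := by
  ext i; simp [phi_apply, tauP_tauP, rhoP_rhoP]

lemma derK_phi {n : ℕ} (k : ℕ) (hk : k ≤ n) (w : Equiv.Perm (Fin n)) (h : derK k w) :
    derK k (phi k hk w) := by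
  intro i hi he
  rw [phi_apply] at he
  have h1 : tauP n k hk i = rhoP n k hk i := by
    ext; simp only [tauP, rhoP, Equiv.coe_fn_mk, tau, rho]; split_ifs <;> omega
  have h2 : w (rhoP n k hk i) = rhoP n k hk i := by
    rw [← h1, ← rhoP_rhoP n k hk (w _), he, h1]
  refine h _ ?_ h2
  have := i.2
  simp only [rhoP, Equiv.coe_fn_mk, rho]; split_ifs <;> omega

lemma starK_phi {n : ℕ} (hn : 1 ≤ n) (k : ℕ) (hk : k ≤ n) (w : Equiv.Perm (Fin n))
    (hk0 : 0 < k) :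
    starK hn k (phi k hk w) ↔ starK hn k w := by
  unfold starK
  have h1 : tauP n k hk ⟨0, hn⟩ = ⟨0, hn⟩ := by
    ext; simp only [tauP, Equiv.coe_fn_mk, tau]; split_ifs <;> omega
  rw [phi_apply, h1]
  have := (w ⟨0, hn⟩).2
  simp only [rhoP, Equiv.coe_fn_mk, rho]; split_ifs <;> omega

lemma starK_phi' {n : ℕ} (hn : 1 ≤ n) (k : ℕ) (hk : k ≤ n) (w : Equiv.Perm (Fin n)) :
    starK hn k (phi k hk w) ↔ starK hn k w := by
  rcases Nat.eq_zero_or_pos k with rfl | h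
  · simp [starK]
  · exact starK_phi hn k hk w h

lemma arith (n k a b : ℕ) (hk : k ≤ n) (ha : a < n) (hb : b < n) (hd : k ≤ a → b ≠ a) :
    (if (a < b ∨ (a < k ∧ b = a)) then 1 else 0) +
    (if (tau n k a < rho n k b ∨ (tau n k a < k ∧ rho n k b = tau n k a)) then 1 else 0) +
    (if (k ≤ a ∧ b < k) then 1 else 0) =
    1 + (if (a < k ∧ k ≤ b) then 1 else 0) + (if (a = 0 ∧ b < k) then 1 else 0) := by
  rcases lt_or_ge a k with h1 | h1 <;> rcases lt_or_ge b k with h2 | h2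
  · have hr : rho n k b = k - 1 - b := if_pos h2
    by_cases h0 : a = 0
    · have ht : tau n k a = 0 := by unfold tau; split_ifs <;> omega
      rw [hr, ht]; split_ifs <;> omega
    · have ht : tau n k a = k - a := by simp [tau, h0, h1]
      rw [hr, ht]; split_ifs <;> omega
  · have hr : rho n k b = n - 1 + k - b := if_neg h2.not_gt
    have ht : tau n k a < k := by
      unfold tau; split_ifs <;> omega
    rw [hr]; split_ifs <;> omega
  · have hr : rho n k b = k - 1 - b := if_pos h2
    have ht : tau n k a = n - 1 + k - a := if_neg h1.not_gt
    rw [hr, ht]; split_ifs <;> omega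
  · have hr : rho n k b = n - 1 + k - b := if_neg h2.not_gt
    have ht : tau n k a = n - 1 + k - a := if_neg h1.not_gt
    have := hd h1
    rw [hr, ht]; split_ifs <;> omega

open Classical in
lemma excK_phi {n : ℕ} (hn : 1 ≤ n) (k : ℕ) (hk : k ≤ n) (w : Equiv.Perm (Fin n))
    (h : derK k w) :
    excK k w + excK k (phi k hk w) = n + (if starK hn k w then 0 else 1) := by
  have e2 : excK k (phi k hk w) = ∑ x : Fin n,
      if (tauP n k hk x < rhoP n k hk (w x) ∨
        ((tauP n k hk x : ℕ) < k ∧ rhoP n k hk (w x) = tauP n k hk x)) then 1 else 0 := by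
    unfold excK
    rw [Finset.card_filter, ← Equiv.sum_comp (tauP n k hk)]
    refine Finset.sum_congr rfl fun x _ => ?_
    simp only [phi_apply, tauP_tauP]
  have e1 : excK k w = ∑ x : Fin n, if (x < w x ∨ ((x : ℕ) < k ∧ w x = x)) then 1 else 0 := by
    unfold excK
    rw [Finset.card_filter]
  have e3 : ∑ x : Fin n, (if ((w x : ℕ) < k) then 1 else 0) =
      ∑ x : Fin n, (if ((x : ℕ) < k) then 1 else 0) :=
    Equiv.sum_comp w (fun x : Fin n => if ((x : ℕ) < k) then 1 else 0)
  have e4 : ∑ x : Fin n, (if ((w x : ℕ) < k) then 1 else 0) +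
      ∑ x : Fin n, (if ((x : ℕ) < k ∧ k ≤ (w x : ℕ)) then 1 else 0) =
      ∑ x : Fin n, (if ((x : ℕ) < k) then 1 else 0) +
      ∑ x : Fin n, (if (k ≤ (x : ℕ) ∧ (w x : ℕ) < k) then 1 else 0) := by
    rw [← Finset.sum_add_distrib, ← Finset.sum_add_distrib]
    refine Finset.sum_congr rfl fun x _ => ?_
    split_ifs <;> omega
  have e5 : ∑ x : Fin n, (if (x = ⟨0, hn⟩ ∧ (w x : ℕ) < k) then 1 else 0) =
      if starK hn k w then 0 else 1 := by
    rw [Finset.sum_eq_single (⟨0, hn⟩ : Fin n)]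
    · unfold starK; split_ifs <;> first | rfl | (exfalso; simp at *; omega)
    · intro b _ hb; simp [hb]
    · simp
  have e6 : ∑ x : Fin n, (1 : ℕ) = n := by simp
  have key : (excK k w + excK k (phi k hk w)) +
      ∑ x : Fin n, (if (k ≤ (x : ℕ) ∧ (w x : ℕ) < k) then 1 else 0) =
      (∑ x : Fin n, (1 : ℕ) +
      ∑ x : Fin n, (if ((x : ℕ) < k ∧ k ≤ (w x : ℕ)) then 1 else 0)) +
      ∑ x : Fin n, (if (x = ⟨0, hn⟩ ∧ (w x : ℕ) < k) then 1 else 0) := by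
    rw [e1, e2]
    simp only [← Finset.sum_add_distrib]
    refine Finset.sum_congr rfl fun x _ => ?_
    have hd : k ≤ (x : ℕ) → (w x : ℕ) ≠ x := fun hx hh => h x hx (Fin.ext hh)
    have hx := x.2
    have hw := (w x).2
    have := arith n k x (w x) hk hx hw hd
    simpa only [Fin.lt_def, Fin.ext_iff, tauP, rhoP, Equiv.coe_fn_mk] using this
  omega

/-! ### Transfer -/

def vS {n : ℕ} (s : Fin n → Bool) (k : Fin n) : ℤ :=
  if s k then ((k : ℤ) + 1) else -((k : ℤ) + 1)

lemma vS_inj {n : ℕ} (s : Fin n → Bool) : Function.Injective (vS s) := by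
  intro a b h
  ext
  unfold vS at h
  split_ifs at h <;> omega

lemma vS_ne {n : ℕ} (s : Fin n → Bool) (a) : vS s a ≠ 0 := by
  unfold vS
  split_ifs <;> omega

def eS {n : ℕ} (s : Fin n → Bool) : Equiv.Perm (Fin n) := Tuple.sort (vS s)

lemma eS_mono {n : ℕ} (s : Fin n → Bool) : StrictMono (fun i => vS s (eS s i)) :=
  (Tuple.monotone_sort (vS s)).strictMono_of_injective ((vS_inj s).comp (eS s).injective)

lemma exists_k {n : ℕ} (s : Fin n → Bool) :
    ∃ k ≤ n, ∀ i : Fin n, vS s (eS s i) < 0 ↔ (i : ℕ) < k := by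
  classical
  have hex : ∃ m, ∀ i : Fin n, m ≤ (i : ℕ) → ¬ vS s (eS s i) < 0 :=
    ⟨n, fun i hi => absurd i.2 (by omega)⟩
  refine ⟨Nat.find hex, Nat.find_min' hex (fun i hi => absurd i.2 (by omega)), fun i => ?_⟩
  constructor
  · intro h
    by_contra hc
    exact Nat.find_spec hex i (by omega) h
  · intro h
    have := Nat.find_min hex h
    push Not at this
    obtain ⟨j, hj, hv⟩ := this
    exact lt_of_le_of_lt ((eS_mono s).monotone (show i ≤ j from hj)) hv

noncomputable def kS {n : ℕ} (s : Fin n → Bool) : ℕ := (exists_k s).choose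
lemma kS_le {n : ℕ} (s : Fin n → Bool) : kS s ≤ n := (exists_k s).choose_spec.1
lemma kS_spec {n : ℕ} (s : Fin n → Bool) (i : Fin n) : vS s (eS s i) < 0 ↔ (i : ℕ) < kS s :=
  (exists_k s).choose_spec.2 i

def mkU {n : ℕ} (s : Fin n → Bool) (w : Equiv.Perm (Fin n)) : Fin n → Fin n × Bool :=
  fun i => (eS s (w ((eS s).symm i)), s (eS s (w ((eS s).symm i))))

lemma mkU_sp {n : ℕ} (s : Fin n → Bool) (w : Equiv.Perm (Fin n)) : IsSP (mkU s w) :=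
  (((eS s).symm.trans w).trans (eS s)).bijective

lemma letterW_mkU {n : ℕ} (s : Fin n → Bool) (w : Equiv.Perm (Fin n)) (i) :
    letterW (mkU s w) (eS s i) = vS s (eS s (w i)) := by
  simp [letterW, mkU, vS]

lemma mkU_ex {n : ℕ} (s : Fin n → Bool) (w : Equiv.Perm (Fin n)) (k : Fin n) :
    (∃ j, mkU s w j = (k, true)) ↔ s k = true := by
  constructor
  · rintro ⟨j, hj⟩
    simp only [mkU, Prod.mk.injEq] at hj
    rw [hj.1] at hj; exact hj.2
  · intro h
    refine ⟨eS s (w.symm ((eS s).symm k)), ?_⟩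
    simp [mkU, h]

lemma aVal_mkU {n : ℕ} (s : Fin n → Bool) (w : Equiv.Perm (Fin n)) (k) :
    aVal (mkU s w) k = vS s k := by
  unfold aVal vS
  simp only [mkU_ex]

lemma excB_mkU {n : ℕ} (s : Fin n → Bool) (w : Equiv.Perm (Fin n)) :
    excB (mkU s w) = excK (kS s) w := by
  unfold excB excK
  rw [Finset.card_filter, Finset.card_filter, ← Equiv.sum_comp (eS s)]
  refine Finset.sum_congr rfl fun i _ => ?_
  have h1 : vS s (eS s i) < vS s (eS s (w i)) ↔ i < w i := (eS_mono s).lt_iff_lt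
  simp only [letterW_mkU, aVal_mkU, kS_spec, h1,
    (vS_inj s).eq_iff, (eS s).injective.eq_iff]

lemma der_mkU {n : ℕ} (s : Fin n → Bool) (w : Equiv.Perm (Fin n)) :
    IsDerB (mkU s w) ↔ derK (kS s) w := by
  unfold IsDerB derK
  rw [← (eS s).forall_congr_right]
  refine forall_congr' fun i => ?_
  rw [letterW_mkU, aVal_mkU, ne_eq, (vS_inj s).eq_iff, (eS s).injective.eq_iff]
  have h1 := kS_spec s i
  have h2 := vS_ne s (eS s i)
  have : 0 < vS s (eS s i) ↔ kS s ≤ (i : ℕ) := by omega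
  rw [this]

lemma star_mkU {n : ℕ} (hn : 1 ≤ n) (s : Fin n → Bool) (w : Equiv.Perm (Fin n)) :
    inBstar (mkU s w) ↔ starK hn (kS s) w := by
  unfold inBstar starK
  have h1 := kS_spec s (w ⟨0, hn⟩)
  have h2 := vS_ne s (eS s (w ⟨0, hn⟩))
  have h3 : 0 < vS s (eS s (w ⟨0, hn⟩)) ↔ kS s ≤ (w ⟨0, hn⟩ : ℕ) := by omega
  rw [← h3]
  simp only [aVal_mkU]
  constructor
  · rintro ⟨k, hk, hl⟩
    have hle := hk (eS s ⟨0, hn⟩)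
    obtain ⟨i, rfl⟩ := (eS s).surjective k
    have : i ≤ ⟨0, hn⟩ := (eS_mono s).le_iff_le.1 hle
    have : i = ⟨0, hn⟩ := le_antisymm this (Nat.zero_le _)
    subst this
    rwa [letterW_mkU] at hl
  · intro h
    refine ⟨eS s ⟨0, hn⟩, fun j => ?_, by rwa [letterW_mkU]⟩
    obtain ⟨i, rfl⟩ := (eS s).surjective j
    exact (eS_mono s).monotone (show (⟨0, hn⟩ : Fin n) ≤ i from Nat.zero_le _)

lemma mkU_inj {n : ℕ} {s s' : Fin n → Bool} {w w' : Equiv.Perm (Fin n)}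
    (h : mkU s w = mkU s' w') : s = s' ∧ w = w' := by
  have hs : s = s' := by
    funext k
    have := mkU_ex s w k
    rw [h, mkU_ex] at this
    exact Bool.eq_iff_iff.2 this.symm
  subst hs
  refine ⟨rfl, ?_⟩
  ext i
  have := congrArg Prod.fst (congrFun h (eS s i))
  simp only [mkU, Equiv.symm_apply_apply, (eS s).injective.eq_iff] at this
  rw [this]

lemma mkU_surj {n : ℕ} (u : Fin n → Fin n × Bool) (hu : IsSP u) :
    ∃ s w, mkU s w = u := by
  let π : Equiv.Perm (Fin n) := Equiv.ofBijective _ hu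
  have hπ : ∀ i, (u i).1 = π i := fun i => rfl
  let s : Fin n → Bool := fun k => (u (π.symm k)).2
  refine ⟨s, ((eS s).trans π).trans (eS s).symm, ?_⟩
  funext i
  refine Prod.ext ?_ ?_
  · simp [mkU, hπ]
  · simp [mkU, s]

/-- the counting form -/
lemma sum_symm {n : ℕ} (hn : 1 ≤ n) (Q : Prop → Prop) [DecidablePred Q] (c : ℕ)
    (hc : ∀ (k : ℕ) (hk : k ≤ n) (w : Equiv.Perm (Fin n)), derK k w → Q (starK hn k w) →
      excK k w + excK k (phi k hk w) = c) (j : ℕ) (hj : j ≤ c)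
    (P : (Fin n → Fin n × Bool) → Prop) [DecidablePred P]
    (hP : ∀ u, P u ↔ (IsSP u ∧ IsDerB u ∧ Q (inBstar u))) :
    (∑ u ∈ univ.filter P, (X : ℝ[X]) ^ excB u).coeff j =
    (∑ u ∈ univ.filter P, (X : ℝ[X]) ^ excB u).coeff (c - j) := by
  classical
  have main : ∀ f : ℕ → ℝ, ∑ u ∈ univ.filter P, f (excB u) =
      ∑ s : Fin n → Bool, ∑ w ∈ univ.filter
        (fun w : Equiv.Perm (Fin n) => derK (kS s) w ∧ Q (starK hn (kS s) w)),
        f (excK (kS s) w) := by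
    intro f
    rw [Finset.sum_sigma']
    symm
    refine Finset.sum_bij (fun x _ => mkU x.1 x.2) ?_ ?_ ?_ ?_
    · rintro ⟨s, w⟩ h
      simp only [mem_sigma, mem_univ, mem_filter, true_and] at h ⊢
      rw [hP, der_mkU, star_mkU hn]
      exact ⟨mkU_sp s w, h⟩
    · rintro ⟨s, w⟩ _ ⟨s', w'⟩ _ h
      obtain ⟨rfl, rfl⟩ := mkU_inj h
      rfl
    · intro u hu
      simp only [mem_filter, mem_univ, true_and, hP] at hu
      obtain ⟨s, w, rfl⟩ := mkU_surj u hu.1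
      refine ⟨⟨s, w⟩, ?_, rfl⟩
      rw [der_mkU, star_mkU hn] at hu
      simpa using hu.2
    · rintro ⟨s, w⟩ _
      simp only [excB_mkU]
  simp only [finsetSum_coeff, coeff_X_pow]
  rw [main (fun e => if j = e then 1 else 0), main (fun e => if c - j = e then 1 else 0)]
  refine Finset.sum_congr rfl fun s _ => ?_
  have hmem : ∀ w ∈ univ.filter
        (fun w : Equiv.Perm (Fin n) => derK (kS s) w ∧ Q (starK hn (kS s) w)),
        phi (kS s) (kS_le s) w ∈ univ.filter
        (fun w : Equiv.Perm (Fin n) => derK (kS s) w ∧ Q (starK hn (kS s) w)) := by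
    intro w hw
    simp only [mem_filter, mem_univ, true_and] at hw ⊢
    exact ⟨derK_phi _ _ _ hw.1, by rw [starK_phi']; exact hw.2⟩
  refine Finset.sum_bij' (fun w _ => phi (kS s) (kS_le s) w) (fun w _ => phi (kS s) (kS_le s) w)
    hmem hmem (fun w _ => phi_phi _ _ w) (fun w _ => phi_phi _ _ w) ?_
  intro w hw
  simp only [mem_filter, mem_univ, true_and] at hw
  have := hc (kS s) (kS_le s) w hw.1 hw.2
  split_ifs <;> first | rfl | omega

lemma excB_le {n : ℕ} (u : Fin n → Fin n × Bool) : excB u ≤ n := by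
  unfold excB
  exact (Finset.card_le_univ _).trans (by simp)

lemma coeff_big {n : ℕ} (F : Finset (Fin n → Fin n × Bool)) (j : ℕ) (hj : n < j) :
    (∑ u ∈ F, (X : ℝ[X]) ^ excB u).coeff j = 0 := by
  rw [finsetSum_coeff]
  refine Finset.sum_eq_zero fun u _ => ?_
  rw [coeff_X_pow, if_neg]
  have := excB_le u
  omega

end FPM

/-- For `n ≥ 1`, `f_n^+(x) = Σ_{w ∈ D_n^B ∩ B_n^*} x^{exc_B(w)}` and
`f_n^-(x) = Σ_{w ∈ D_n^B ∖ B_n^*} x^{exc_B(w)}`. -/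
theorem fplus_fminus_combinatorial (n : ℕ) (hn : 1 ≤ n)
    (fp fm : Polynomial ℝ)
    (hsum : dB n = fp + fm)
    (hpdeg : fp.degree ≤ (n : WithBot ℕ))
    (hpsymm : ∀ k ≤ n, fp.coeff k = fp.coeff (n - k))
    (hmdeg : fm.degree ≤ ((n + 1 : ℕ) : WithBot ℕ))
    (hmsymm : ∀ k ≤ n + 1, fm.coeff k = fm.coeff (n + 1 - k))
    :
    fp = (∑ u ∈ univ.filter (fun u : Fin n → Fin n × Bool =>
            IsSP u ∧ IsDerB u ∧ inBstar u), X ^ excB u) ∧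
    fm = (∑ u ∈ univ.filter (fun u : Fin n → Fin n × Bool =>
            IsSP u ∧ IsDerB u ∧ ¬ inBstar u), X ^ excB u) := by
  classical
  set P : Polynomial ℝ := ∑ u ∈ univ.filter (fun u : Fin n → Fin n × Bool =>
            IsSP u ∧ IsDerB u ∧ inBstar u), X ^ excB u with hPdef
  set M : Polynomial ℝ := ∑ u ∈ univ.filter (fun u : Fin n → Fin n × Bool =>
            IsSP u ∧ IsDerB u ∧ ¬ inBstar u), X ^ excB u with hMdef
  have hPs : ∀ j ≤ n, P.coeff j = P.coeff (n - j) := fun j hj =>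
    FPM.sum_symm hn (fun p => p) n
      (fun k hk w h1 h2 => by rw [FPM.excK_phi hn k hk w h1, if_pos h2]; rfl) j hj _
      (fun u => Iff.rfl)
  have hMs : ∀ j ≤ n + 1, M.coeff j = M.coeff (n + 1 - j) := fun j hj =>
    FPM.sum_symm hn (fun p => ¬ p) (n + 1)
      (fun k hk w h1 h2 => by rw [FPM.excK_phi hn k hk w h1, if_neg h2]) j hj _
      (fun u => Iff.rfl)
  have hPM : dB n = P + M := by
    rw [dB, hPdef, hMdef, ← Finset.sum_filter_add_sum_filter_not _ (fun u => inBstar u),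
      Finset.filter_filter, Finset.filter_filter]
    simp only [and_assoc]
  have hPb : ∀ j, n < j → P.coeff j = 0 := fun j hj => FPM.coeff_big _ j hj
  have hfb : ∀ j, n < j → fp.coeff j = 0 := fun j hj =>
    coeff_eq_zero_of_degree_lt (lt_of_le_of_lt hpdeg (by exact_mod_cast hj))
  have hs : ∀ j, fp.coeff j + fm.coeff j = P.coeff j + M.coeff j := fun j => by
    rw [← coeff_add, ← coeff_add, ← hsum, hPM]
  have hrefl : ∀ j ≤ n + 1, fp.coeff j - P.coeff j =
      fp.coeff (n + 1 - j) - P.coeff (n + 1 - j) := fun j hj => by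
    have h1 := hs j
    have h2 := hs (n + 1 - j)
    have h3 := hMs j hj
    have h4 := hmsymm j hj
    linarith
  have hz : ∀ j, j ≤ n → fp.coeff j - P.coeff j = 0 := by
    intro j
    induction j with
    | zero =>
      intro _
      rw [hrefl 0 (by omega), hPb _ (by omega), hfb _ (by omega), sub_zero]
    | succ j ih =>
      intro hj
      rw [hrefl (j + 1) (by omega), show n + 1 - (j + 1) = n - j by omega,
        ← hPs j (by omega), ← hpsymm j (by omega)]
      exact ih (by omega)
  have hfp : fp = P := by
    ext j
    rcases le_or_gt j n with h | h
    · linarith [hz j h]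
    · rw [hPb j h, hfb j h]
  refine ⟨hfp, ?_⟩
  rw [hPM, hfp] at hsum
  exact (add_left_cancel hsum).symm
end
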